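/- arXiv:2306.17378 — 14 statements merged into one kernel-verified Lean document; each statement's English description precedes it below -/
import Mathlib

section
/- Let a > 0. Consider the function f(x,y) = ((1 − a·y)² + y² + (a − x)² + 1)/2 on ℝ². Then (x,y) = (a, 0) is the unique global minimizer of f over the constraint set {(x,y) ∈ ℝ² : x·y = 0}, f(a,0) = 1, and for every (x,y) with x·y = 0 and (x,y) ≠ (a,0) one has f(x,y) > 1. -/
/-- For `a > 0` and `f(x,y) = ((1 - a*y)^2 + y^2 + (a - x)^2 + 1)/2`,
the point `(a, 0)` is the unique global minimizer of `f` over `{(x,y) : x*y = 0}`: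
`f(a,0) = 1` and `f(x,y) > 1` for every other point of the constraint set. -/
theorem stmt0 (a : ℝ) (ha : 0 < a)
    (f : ℝ → ℝ → ℝ)
    (hf : ∀ x y, f x y = ((1 - a * y) ^ 2 + y ^ 2 + (a - x) ^ 2 + 1) / 2) :
    a * 0 = 0 ∧ f a 0 = 1 ∧
      ∀ x y : ℝ, x * y = 0 → (x, y) ≠ (a, 0) → f x y > 1 := by
  refine ⟨mul_zero a, by rw [hf]; ring, ?_⟩
  intro x y hxy hne
  rw [hf]
  by_cases hy : y = 0
  · subst hy
    have hx : a - x ≠ 0 := by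
      intro h
      apply hne
      have : x = a := by linarith
      rw [this]
    have : 0 < (a - x) ^ 2 := by positivity
    nlinarith
  · have hx : x = 0 := by
      rcases mul_eq_zero.mp hxy with h | h
      · exact h
      · exact absurd h hy
    subst hx
    have h1 : 0 < (a * y) ^ 2 := by positivity
    nlinarith [sq_nonneg (a - y)]
end

section
/- Let a > 0. If μ > a²/4 then ∂r/∂y (y;μ) < 0 for all y > 0. If 0 < μ ≤ a²/4 then ∂r/∂y (y;μ) > 0 for y_lb(μ) < y < y_ub(μ) and ∂r/∂y (y;μ) ≤ 0 for all other y > 0; moreover y_lb(μ) ≤ √μ ≤ y_ub(μ). -/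
/-- `r(y; μ) = a/y - μ a² / (y² + μ)² - (a² + 1)`. -/
noncomputable def r (a μ y : ℝ) : ℝ :=
  a / y - μ * a ^ 2 / (y ^ 2 + μ) ^ 2 - (a ^ 2 + 1)

/-- `y_lb(μ) = ((4μ)^{1/3}/2)(a^{1/3} - √(a^{2/3} - (4μ)^{1/3}))`. -/
noncomputable def ylb (a μ : ℝ) : ℝ :=
  (4 * μ) ^ ((1 : ℝ) / 3) / 2 *
    (a ^ ((1 : ℝ) / 3) - Real.sqrt (a ^ ((2 : ℝ) / 3) - (4 * μ) ^ ((1 : ℝ) / 3)))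

/-- `y_ub(μ) = ((4μ)^{1/3}/2)(a^{1/3} + √(a^{2/3} - (4μ)^{1/3}))`. -/
noncomputable def yub (a μ : ℝ) : ℝ :=
  (4 * μ) ^ ((1 : ℝ) / 3) / 2 *
    (a ^ ((1 : ℝ) / 3) + Real.sqrt (a ^ ((2 : ℝ) / 3) - (4 * μ) ^ ((1 : ℝ) / 3)))

lemma aux_deriv (a μ y : ℝ) (hμ : 0 < μ) (hy : 0 < y) :
    deriv (fun y : ℝ => r a μ y) y
      = a / (y ^ 2 * (y ^ 2 + μ) ^ 3) * (4 * μ * a * y ^ 3 - (y ^ 2 + μ) ^ 3) := by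
  have hp : 0 < y ^ 2 + μ := by positivity
  have h1 : HasDerivAt (fun y : ℝ => a / y) ((0 * y - a * 1) / y ^ 2) y :=
    (hasDerivAt_const y a).div (hasDerivAt_id' y) hy.ne'
  have h2 : HasDerivAt (fun y : ℝ => (y ^ 2 + μ) ^ 2) (2 * (y ^ 2 + μ) * (2 * y)) y := by
    have := (((hasDerivAt_id' y).pow 2).add_const μ).pow 2
    have e : 2 * (y ^ 2 + μ) * (2 * y) = ((2 : ℕ) : ℝ) * (y ^ 2 + μ) ^ (2 - 1) * (((2 : ℕ) : ℝ) * y ^ (2 - 1) * 1) := by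
      norm_num
    rw [e]
    exact this
  have h3 : HasDerivAt (fun y : ℝ => μ * a ^ 2 / (y ^ 2 + μ) ^ 2) _ y :=
    (hasDerivAt_const y (μ * a ^ 2)).div h2 (by positivity)
  have h4 := (h1.sub h3).sub_const (a ^ 2 + 1)
  have h5 : deriv (fun y : ℝ => r a μ y) y = _ := h4.deriv
  rw [h5]
  field_simp
  ring

lemma aux_pos (a μ m b y : ℝ) (ha : 0 < a) (hμ : 0 < μ) (hy : 0 < y)
    (hm : m ^ 3 = 4 * μ) (hb : b ^ 3 = a) :
    (0 < m * b * y - (y ^ 2 + μ) → 0 < deriv (fun y : ℝ => r a μ y) y) ∧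
    (m * b * y - (y ^ 2 + μ) ≤ 0 → deriv (fun y : ℝ => r a μ y) y ≤ 0) ∧
    (m * b * y - (y ^ 2 + μ) < 0 → deriv (fun y : ℝ => r a μ y) y < 0) := by
  have hc : 4 * μ * a * y ^ 3 = (m * b * y) ^ 3 := by rw [← hm, ← hb]; ring
  have hodd : Odd 3 := by decide
  have hk : 0 < a / (y ^ 2 * (y ^ 2 + μ) ^ 3) := by positivity
  rw [aux_deriv a μ y hμ hy, hc]
  refine ⟨fun h => mul_pos hk ?_, fun h => mul_nonpos_of_nonneg_of_nonpos hk.le ?_,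
    fun h => mul_neg_of_pos_of_neg hk ?_⟩
  · exact sub_pos.2 (hodd.pow_lt_pow.2 (sub_pos.1 h))
  · exact sub_nonpos.2 (hodd.pow_le_pow.2 (sub_nonpos.1 h))
  · exact sub_neg.2 (hodd.pow_lt_pow.2 (sub_neg.1 h))

/-- sign of `∂r/∂y`: for `μ > a²/4` it is negative on `(0,∞)`; for
`0 < μ ≤ a²/4` it is positive exactly on `(y_lb, y_ub)` and nonpositive elsewhere on
`(0,∞)`; moreover `y_lb ≤ √μ ≤ y_ub`. -/
theorem stmt3 (a μ : ℝ) (ha : 0 < a) (hμ : 0 < μ) :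
    (a ^ 2 / 4 < μ → ∀ y : ℝ, 0 < y → deriv (fun y : ℝ => r a μ y) y < 0) ∧
    (μ ≤ a ^ 2 / 4 →
      (∀ y : ℝ, ylb a μ < y → y < yub a μ → 0 < deriv (fun y : ℝ => r a μ y) y) ∧
      (∀ y : ℝ, 0 < y → (y ≤ ylb a μ ∨ yub a μ ≤ y) →
        deriv (fun y : ℝ => r a μ y) y ≤ 0) ∧
      ylb a μ ≤ Real.sqrt μ ∧ Real.sqrt μ ≤ yub a μ) := by
  have hm : ((4 * μ) ^ ((1 : ℝ) / 3)) ^ 3 = 4 * μ := by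
    rw [← Real.rpow_natCast, ← Real.rpow_mul (by positivity)]; norm_num
  have hb : (a ^ ((1 : ℝ) / 3)) ^ 3 = a := by
    rw [← Real.rpow_natCast, ← Real.rpow_mul (by positivity)]; norm_num
  have hb2 : a ^ ((2 : ℝ) / 3) = (a ^ ((1 : ℝ) / 3)) ^ 2 := by
    rw [← Real.rpow_natCast, ← Real.rpow_mul (by positivity)]; norm_num
  have hm0 : 0 < (4 * μ) ^ ((1 : ℝ) / 3) := by positivity
  have hb0 : 0 < a ^ ((1 : ℝ) / 3) := by positivity
  unfold ylb yub
  rw [hb2]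
  generalize (4 * μ) ^ ((1 : ℝ) / 3) = m at *
  generalize a ^ ((1 : ℝ) / 3) = b at *
  have ha6 : (b ^ 2) ^ 3 = a ^ 2 := by rw [← hb]; ring
  refine ⟨fun h y hy => ?_, fun h => ?_⟩
  · have hlt : b ^ 2 < m := by
      apply lt_of_pow_lt_pow_left₀ 3 hm0.le
      rw [ha6, hm]; linarith
    apply (aux_pos a μ m b y ha hμ hy hm hb).2.2
    have h1 : 0 < m ^ 2 * (m - b ^ 2) := mul_pos (by positivity) (sub_pos.2 hlt)
    nlinarith [sq_nonneg (2 * y - m * b)]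
  · have hle : m ≤ b ^ 2 := by
      apply le_of_pow_le_pow_left₀ (n := 3) (by norm_num) (by positivity)
      rw [ha6, hm]; linarith
    have hs2 := Real.sq_sqrt (sub_nonneg.2 hle)
    have hs0 := Real.sqrt_nonneg (b ^ 2 - m)
    generalize √(b ^ 2 - m) = s at *
    have hsb : s < b := by
      apply lt_of_pow_lt_pow_left₀ 2 hb0.le
      linarith
    have hl0 : 0 < m / 2 * (b - s) := mul_pos (by positivity) (sub_pos.2 hsb)
    have hlu : m / 2 * (b - s) ≤ m / 2 * (b + s) :=
      mul_le_mul_of_nonneg_left (by linarith) (by positivity)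
    have hf : ∀ y, m * b * y - (y ^ 2 + μ)
        = (y - m / 2 * (b - s)) * (m / 2 * (b + s) - y) := by
      intro y
      have : μ = m ^ 3 / 4 := by linarith
      rw [this]
      linear_combination -(m ^ 2 / 4) * hs2
    generalize m / 2 * (b - s) = l at *
    generalize m / 2 * (b + s) = u at *
    have hq : 0 ≤ (√μ - l) * (u - √μ) := by
      rw [← hf, Real.sq_sqrt hμ.le]
      have : 2 * √μ ≤ m * b := by
        apply le_of_pow_le_pow_left₀ (n := 2) (by norm_num) (by positivity)
        rw [mul_pow, mul_pow, Real.sq_sqrt hμ.le]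
        nlinarith [mul_le_mul_of_nonneg_left hle (sq_nonneg m)]
      nlinarith [mul_le_mul_of_nonneg_right this (Real.sqrt_nonneg μ), Real.sq_sqrt hμ.le]
    refine ⟨fun y h1 h2 => ?_, fun y hy h1 => ?_, ?_, ?_⟩
    · apply (aux_pos a μ m b y ha hμ (hl0.trans h1) hm hb).1
      rw [hf]
      exact mul_pos (by linarith) (by linarith)
    · apply (aux_pos a μ m b y ha hμ hy hm hb).2.1
      rw [hf]
      rcases h1 with h1 | h1
      · exact mul_nonpos_of_nonpos_of_nonneg (by linarith) (by linarith)
      · exact mul_nonpos_of_nonneg_of_nonpos (by linarith) (by linarith)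
    · by_contra! hc
      nlinarith
    · by_contra! hc
      nlinarith
end

section
/- Let a > 0 and define p(μ) = r(y_ub(μ); μ) for 0 < μ < a²/4. Then p is strictly decreasing on (0, a²/4), p(μ) → +∞ as μ → 0⁺, p(μ) < 0 as μ → (a²/4)⁻, and p has a unique zero τ in (0, a²/4). -/
open Filter Topology

/-- `p(μ) = r(y_ub(μ); μ)`. -/
noncomputable def pfun (a μ : ℝ) : ℝ := r a μ (yub a μ)

noncomputable def auxS (A μ : ℝ) : ℝ := Real.sqrt (A ^ 2 - (4 * μ) ^ ((1 : ℝ) / 3))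
noncomputable def auxG (A s : ℝ) : ℝ :=
  A ^ 3 * (A + 2 * s) / ((A - s) * (A + s) ^ 3) - (A ^ 6 + 1)

lemma auxS_cont (A : ℝ) : Continuous (auxS A) := by
  unfold auxS
  refine Real.continuous_sqrt.comp (continuous_const.sub ?_)
  exact (continuous_const.mul continuous_id).rpow_const (fun x => Or.inr (by norm_num))

lemma aux_cube (x : ℝ) (hx : 0 ≤ x) : (x ^ ((1 : ℝ) / 3)) ^ 3 = x := by
  rw [← Real.rpow_natCast, ← Real.rpow_mul hx]; norm_num

lemma auxS_zero (A : ℝ) (hA : 0 < A) : auxS A 0 = A := by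
  unfold auxS
  rw [mul_zero, Real.zero_rpow (by norm_num), sub_zero, Real.sqrt_sq hA.le]

lemma aux_m (A μ : ℝ) (hA : 0 < A) (h0 : 0 < μ) (h1 : μ < A ^ 6 / 4) :
    0 < (4 * μ) ^ ((1 : ℝ) / 3) ∧ (4 * μ) ^ ((1 : ℝ) / 3) < A ^ 2 := by
  refine ⟨by positivity, ?_⟩
  have := aux_cube (4 * μ) (by positivity)
  refine lt_of_pow_lt_pow_left₀ 3 (by positivity) ?_
  rw [this]; nlinarith

lemma auxS_end (A : ℝ) (hA : 0 < A) : auxS A (A ^ 6 / 4) = 0 := by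
  unfold auxS
  have : (4 * (A ^ 6 / 4)) ^ ((1 : ℝ) / 3) = A ^ 2 := by
    have h : 4 * (A ^ 6 / 4) = (A ^ 2) ^ (3 : ℝ) := by
      rw [show (3 : ℝ) = ((3 : ℕ) : ℝ) by norm_num, Real.rpow_natCast]; ring
    rw [h, ← Real.rpow_mul (by positivity)]; norm_num
  rw [this]; simp

lemma auxS_mem (A μ : ℝ) (hA : 0 < A) (h0 : 0 < μ) (h1 : μ < A ^ 6 / 4) :
    0 < auxS A μ ∧ auxS A μ < A := by
  obtain ⟨p, q⟩ := aux_m A μ hA h0 h1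
  unfold auxS
  refine ⟨Real.sqrt_pos.2 (by linarith), ?_⟩
  rw [Real.sqrt_lt' hA]; linarith

lemma auxS_anti (A μ ν : ℝ) (hA : 0 < A) (h0 : 0 < μ) (hv : μ < ν) (h1 : ν < A ^ 6 / 4) :
    auxS A ν < auxS A μ := by
  obtain ⟨p, q⟩ := aux_m A ν hA (h0.trans hv) h1
  unfold auxS
  apply Real.sqrt_lt_sqrt (by linarith)
  have := Real.rpow_lt_rpow (x := 4 * μ) (y := 4 * ν) (z := 1 / 3) (by positivity) (by linarith)
    (by norm_num)
  linarith

lemma auxG_mono (A s t : ℝ) (hA : 0 < A) (hs : 0 < s) (hst : s < t) (ht : t < A) :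
    auxG A s < auxG A t := by
  unfold auxG
  have h1 : 0 < A - t := by linarith
  have h2 : 0 < A - s := by linarith
  have h3 : 0 < t := by linarith
  have e : ∀ x, (A - x) * (A + x) ^ 3 = A ^ 3 * (A + 2 * x) - x ^ 3 * (2 * A + x) := by
    intro x; ring
  have key : s ^ 3 * (2 * A + s) * (A + 2 * t) < t ^ 3 * (2 * A + t) * (A + 2 * s) := by
    have k1 : s ^ 2 < t ^ 2 := by gcongr
    have k2 : s * (A + 2 * t) < t * (A + 2 * s) := by nlinarith
    calc s ^ 3 * (2 * A + s) * (A + 2 * t)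
        = s ^ 2 * (2 * A + s) * (s * (A + 2 * t)) := by ring
      _ < t ^ 2 * (2 * A + t) * (t * (A + 2 * s)) := by gcongr
      _ = _ := by ring
  have : A ^ 3 * (A + 2 * s) / ((A - s) * (A + s) ^ 3) <
      A ^ 3 * (A + 2 * t) / ((A - t) * (A + t) ^ 3) := by
    rw [div_lt_div_iff₀ (by positivity) (by positivity), e, e]
    have := mul_lt_mul_of_pos_left key (pow_pos hA 3)
    nlinarith
  linarith

lemma auxG_contAt (A s : ℝ) (hA : 0 < A) (hs : 0 ≤ s) (h : s < A) :
    ContinuousAt (auxG A) s := by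
  unfold auxG
  have h1 : 0 < A - s := by linarith
  have : (A - s) * (A + s) ^ 3 ≠ 0 := by positivity
  fun_prop (disch := assumption)

lemma auxG_tendsto (A : ℝ) (hA : 0 < A) : Tendsto (auxG A) (𝓝[<] A) atTop := by
  have h1 : Tendsto (fun s : ℝ => A ^ 3 * (A + 2 * s) / (A + s) ^ 3) (𝓝[<] A)
      (𝓝 (A ^ 3 * (A + 2 * A) / (A + A) ^ 3)) := by
    have : ContinuousAt (fun s : ℝ => A ^ 3 * (A + 2 * s) / (A + s) ^ 3) A := by
      have : (A + A) ^ 3 ≠ 0 := by positivity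
      fun_prop (disch := assumption)
    exact this.tendsto.mono_left nhdsWithin_le_nhds
  have h2 : Tendsto (fun s : ℝ => (A - s)⁻¹) (𝓝[<] A) atTop := by
    apply Tendsto.inv_tendsto_nhdsGT_zero
    rw [tendsto_nhdsWithin_iff]
    constructor
    · have : Tendsto (fun s : ℝ => A - s) (𝓝 A) (𝓝 (A - A)) :=
        (continuous_const.sub continuous_id).tendsto A
      rw [sub_self] at this
      exact this.mono_left nhdsWithin_le_nhds
    · filter_upwards [self_mem_nhdsWithin] with s hs
      simpa using hs
  have h3 := tendsto_atTop_add_const_right _ (-(A ^ 6 + 1)) (h1.pos_mul_atTop (by positivity) h2)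
  refine h3.congr fun s => ?_
  unfold auxG
  rw [← div_eq_mul_inv, div_div, mul_comm ((A + s) ^ 3)]; ring

lemma pfun_eq (A μ : ℝ) (hA : 0 < A) (h0 : 0 < μ) (h1 : μ < A ^ 6 / 4) :
    pfun (A ^ 3) μ = auxG A (auxS A μ) := by
  obtain ⟨p, q⟩ := aux_m A μ hA h0 h1
  obtain ⟨hs0, hs1⟩ := auxS_mem A μ hA h0 h1
  have e1 : (A ^ 3) ^ ((1 : ℝ) / 3) = A := by
    rw [← Real.rpow_natCast, ← Real.rpow_mul hA.le]; norm_num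
  have e2 : (A ^ 3) ^ ((2 : ℝ) / 3) = A ^ 2 := by
    rw [← Real.rpow_natCast, ← Real.rpow_mul hA.le]; norm_num
  have hc := aux_cube (4 * μ) (by positivity)
  have hsq : auxS A μ ^ 2 = A ^ 2 - (4 * μ) ^ ((1 : ℝ) / 3) := by
    unfold auxS; exact Real.sq_sqrt (by linarith)
  have hy : yub (A ^ 3) μ = (4 * μ) ^ ((1 : ℝ) / 3) / 2 * (A + auxS A μ) := by
    unfold yub auxS; rw [e1, e2]
  unfold pfun
  rw [hy]
  generalize (4 * μ) ^ ((1 : ℝ) / 3) = m at *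
  generalize auxS A μ = s at *
  obtain rfl : m = (A - s) * (A + s) := by linarith
  have h2 : 0 < A - s := by linarith
  have hμ : μ = ((A - s) * (A + s)) ^ 3 / 4 := by linarith
  have hk : ((A - s) * (A + s) / 2 * (A + s)) ^ 2 + μ
      = A * ((A - s) * (A + s)) ^ 2 * (A + s) / 2 := by rw [hμ]; ring
  unfold r auxG
  rw [hk, hμ]
  field_simp
  ring

/-- `p` is strictly decreasing on `(0, a²/4)`, `p(μ) → +∞` as `μ → 0⁺`,
`p(μ) < 0` as `μ → (a²/4)⁻`, and `p` has a unique zero `τ` in `(0, a²/4)`. -/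
theorem stmt4 (a : ℝ) (ha : 0 < a) :
    StrictAntiOn (pfun a) (Set.Ioo 0 (a ^ 2 / 4)) ∧
    Tendsto (pfun a) (𝓝[>] (0 : ℝ)) atTop ∧
    (∀ᶠ μ in 𝓝[<] (a ^ 2 / 4), pfun a μ < 0) ∧
    (∃! τ : ℝ, τ ∈ Set.Ioo 0 (a ^ 2 / 4) ∧ pfun a τ = 0) := by
  obtain ⟨A, hA, rfl⟩ : ∃ A : ℝ, 0 < A ∧ a = A ^ 3 :=
    ⟨a ^ ((1 : ℝ) / 3), by positivity, (aux_cube a ha.le).symm⟩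
  have e6 : (A ^ 3) ^ 2 / 4 = A ^ 6 / 4 := by ring
  rw [e6]
  have h6 : 0 < A ^ 6 / 4 := by positivity
  have anti : StrictAntiOn (pfun (A ^ 3)) (Set.Ioo 0 (A ^ 6 / 4)) := by
    intro x hx y hy hxy
    rw [pfun_eq A x hA hx.1 hx.2, pfun_eq A y hA hy.1 hy.2]
    exact auxG_mono A _ _ hA (auxS_mem A y hA hy.1 hy.2).1
      (auxS_anti A x y hA hx.1 hxy hy.2) (auxS_mem A x hA hx.1 hx.2).2
  have ev0 : ∀ᶠ x in 𝓝[>] (0 : ℝ), x ∈ Set.Ioo 0 (A ^ 6 / 4) := Ioo_mem_nhdsGT h6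
  have ev1 : ∀ᶠ x in 𝓝[<] (A ^ 6 / 4), x ∈ Set.Ioo 0 (A ^ 6 / 4) := Ioo_mem_nhdsLT h6
  have top : Tendsto (pfun (A ^ 3)) (𝓝[>] (0 : ℝ)) atTop := by
    have hS : Tendsto (auxS A) (𝓝[>] (0 : ℝ)) (𝓝[<] A) := by
      rw [tendsto_nhdsWithin_iff]
      constructor
      · have := (auxS_cont A).tendsto 0
        rw [auxS_zero A hA] at this
        exact this.mono_left nhdsWithin_le_nhds
      · filter_upwards [ev0] with x hx
        exact (auxS_mem A x hA hx.1 hx.2).2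
    refine ((auxG_tendsto A hA).comp hS).congr' ?_
    filter_upwards [ev0] with x hx
    exact (pfun_eq A x hA hx.1 hx.2).symm
  have neg : ∀ᶠ μ in 𝓝[<] (A ^ 6 / 4), pfun (A ^ 3) μ < 0 := by
    have hS : Tendsto (auxS A) (𝓝[<] (A ^ 6 / 4)) (𝓝 0) := by
      have := (auxS_cont A).tendsto (A ^ 6 / 4)
      rw [auxS_end A hA] at this
      exact this.mono_left nhdsWithin_le_nhds
    have hG := (auxG_contAt A 0 hA le_rfl hA).tendsto.comp hS
    have hneg : auxG A 0 < 0 := by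
      have : auxG A 0 = - A ^ 6 := by
        unfold auxG; rw [mul_zero, add_zero, sub_zero]; field_simp; ring
      rw [this]; have : 0 < A ^ 6 := by positivity
      linarith
    filter_upwards [ev1, hG.eventually (gt_mem_nhds hneg)] with x hx h
    rw [pfun_eq A x hA hx.1 hx.2]; exact h
  refine ⟨anti, top, neg, ?_⟩
  have cont : ContinuousOn (pfun (A ^ 3)) (Set.Ioo 0 (A ^ 6 / 4)) := by
    have : ContinuousOn (fun x => auxG A (auxS A x)) (Set.Ioo 0 (A ^ 6 / 4)) := by
      intro x hx
      obtain ⟨p, q⟩ := auxS_mem A x hA hx.1 hx.2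
      exact (ContinuousAt.comp (f := auxS A) (g := auxG A) (auxG_contAt A _ hA p.le q)
        (auxS_cont A).continuousAt).continuousWithinAt
    exact this.congr fun x hx => pfun_eq A x hA hx.1 hx.2
  obtain ⟨u, hu, hu'⟩ := (ev0.and (top.eventually_gt_atTop 0)).exists
  obtain ⟨v, hv, hv'⟩ := (ev1.and neg).exists
  obtain ⟨τ, hτ, hz⟩ := isPreconnected_Ioo.intermediate_value hv hu cont
    (show (0 : ℝ) ∈ Set.Icc _ _ from ⟨hv'.le, hu'.le⟩)
  exact ⟨τ, ⟨hτ, hz⟩, fun y hy => anti.injOn hy.1 hτ (hy.2.trans hz.symm)⟩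
end

section
/- Let a > 0. There exists τ with 0 < τ < a²/4 such that: for every μ > τ the equation r(y;μ) = 0 has exactly one solution y > 0; for μ = τ it has exactly two solutions y > 0; and for every 0 < μ < τ it has exactly three solutions y > 0. All solutions lie in the interval (0, a/(a²+1)). -/
noncomputable def pf (a x : ℝ) : ℝ := Real.sqrt ((x ^ 2 + a ^ 2) / (1 + a ^ 2))

lemma pf_sq (a x : ℝ) : pf a x ^ 2 = (x ^ 2 + a ^ 2) / (1 + a ^ 2) :=
  Real.sq_sqrt (by positivity)

lemma pf_pos {a : ℝ} (ha : 0 < a) (x : ℝ) : 0 < pf a x :=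
  Real.sqrt_pos.mpr (by positivity)

lemma pf_one (a x : ℝ) : (1 - pf a x ^ 2) * (1 + a ^ 2) = 1 - x ^ 2 := by
  have h : (1 + a ^ 2) ≠ 0 := by positivity
  rw [pf_sq]; field_simp; ring

lemma pf_lt_one {a : ℝ} (ha : 0 < a) {x : ℝ} (h1 : -1 < x) (h2 : x < 1) : pf a x < 1 := by
  have h := pf_one a x
  have hp := pf_pos ha x
  have : 0 < 1 - x ^ 2 := by nlinarith
  by_contra hc
  push Not at hc
  nlinarith [mul_nonneg (show 0 ≤ pf a x ^ 2 - 1 by nlinarith) (show 0 ≤ 1 + a ^ 2 by positivity)]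

lemma pf_gt {a : ℝ} (ha : 0 < a) {x : ℝ} (h1 : -1 < x) (h2 : x < 1) : |x| < pf a x := by
  refine abs_lt_of_sq_lt_sq ?_ (pf_pos ha x).le
  rw [pf_sq, lt_div_iff₀ (by positivity)]
  have : 0 < 1 - x ^ 2 := by nlinarith
  nlinarith [mul_pos this (pow_pos ha 2)]

lemma pf_deriv {a : ℝ} (ha : 0 < a) (x : ℝ) :
    HasDerivAt (pf a) (x / ((1 + a ^ 2) * pf a x)) x := by
  have hp := pf_pos ha x
  have h : HasDerivAt (fun x : ℝ => (x ^ 2 + a ^ 2) / (1 + a ^ 2)) (2 * x / (1 + a ^ 2)) x := by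
    have := (((hasDerivAt_id x).pow 2).add_const (a ^ 2)).div_const (1 + a ^ 2)
    simpa using this
  have h2 := h.sqrt (by positivity)
  refine h2.congr_deriv ?_
  change _ / (2 * pf a x) = _
  field_simp

lemma pf_cont (a : ℝ) : Continuous (pf a) := by
  unfold pf; fun_prop

noncomputable def kf (a x : ℝ) : ℝ := (1 + a ^ 2) * (1 + x) * (1 + pf a x) ^ 2 / (1 - x)
noncomputable def hf (a x : ℝ) : ℝ := (1 + x) ^ 3 * (1 - x) / ((1 + a ^ 2) * (1 + pf a x) ^ 2)

lemma kf_eq {a : ℝ} (ha : 0 < a) {x : ℝ} (h1 : -1 < x) (h2 : x < 1) :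
    kf a x * (1 - pf a x) = (1 + x) ^ 2 * (1 + pf a x) := by
  have h := pf_one a x
  have : (1 - x) ≠ 0 := by linarith
  unfold kf
  rw [div_mul_eq_mul_div, div_eq_iff this]
  linear_combination (1 + x) * (1 + pf a x) * h

lemma hf_eq {a : ℝ} (ha : 0 < a) (x : ℝ) :
    hf a x * (1 + pf a x) = (1 + x) ^ 2 * (1 - pf a x) := by
  have h := pf_one a x
  have hp := pf_pos ha x
  unfold hf
  rw [div_mul_eq_mul_div, div_eq_iff (by positivity)]
  linear_combination -(1 + x) ^ 2 * (1 + pf a x) * h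

lemma kf_cont (a : ℝ) : ContinuousOn (kf a) (Set.Ico (-1) 1) := by
  have := pf_cont a
  unfold kf
  refine ContinuousOn.div (by fun_prop) (by fun_prop) ?_
  intro x hx; have := hx.2; linarith

lemma hf_cont {a : ℝ} (ha : 0 < a) : Continuous (hf a) := by
  have := pf_cont a
  unfold hf
  refine Continuous.div (by fun_prop) (by fun_prop) ?_
  intro x; have := pf_pos ha x; positivity

lemma kf_mono {a : ℝ} (ha : 0 < a) : StrictMonoOn (kf a) (Set.Ico (-1) 1) := by
  apply strictMonoOn_of_deriv_pos (convex_Ico _ _) (kf_cont a)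
  intro x hx
  rw [interior_Ico] at hx
  obtain ⟨h1, h2⟩ := hx
  have hp := pf_pos ha x
  have hp1 := pf_lt_one ha h1 h2
  have hgt := abs_lt.mp (pf_gt ha h1 h2)
  have hx1 : 1 - x ≠ 0 := by linarith
  have hd := ((((hasDerivAt_id x).const_add 1).const_mul (1 + a ^ 2)).mul
    (((pf_deriv ha x).const_add 1).pow 2)).div ((hasDerivAt_id x).const_sub 1) hx1
  have hd2 : HasDerivAt (kf a) (2 * (1 + a ^ 2) * (1 + pf a x) ^ 2 / (1 - x) ^ 2 *
      (1 + x * (1 - pf a x) / pf a x)) x := by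
    refine HasDerivAt.congr_deriv (f := kf a) hd ?_
    have h := pf_one a x
    simp
    field_simp
    linear_combination (-2 * x) * h
  rw [hd2.deriv]
  have : 0 < 1 + x * (1 - pf a x) / pf a x := by
    rw [← div_self hp.ne', ← add_div]
    apply div_pos _ hp
    rw [div_self hp.ne']
    nlinarith
  have : 0 < 1 - x := by linarith
  positivity

lemma hf_deriv {a : ℝ} (ha : 0 < a) (x : ℝ) :
    HasDerivAt (hf a) (2 * (1 + x) ^ 2 / ((1 + a ^ 2) * (1 + pf a x) ^ 2) *
      (1 - x - x / pf a x)) x := by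
  have hp := pf_pos ha x
  have hd := ((((hasDerivAt_id x).const_add 1).pow 3).mul ((hasDerivAt_id x).const_sub 1)).div
    ((((pf_deriv ha x).const_add 1).pow 2).const_mul (1 + a ^ 2)) (by
      show (1 + a ^ 2) * (1 + pf a x) ^ 2 ≠ 0
      positivity)
  refine HasDerivAt.congr_deriv (f := hf a) hd ?_
  have h := pf_one a x
  simp
  field_simp
  linear_combination (2 * x * (1 + x) ^ 2) * h

lemma ratio_mono {a : ℝ} (ha : 0 < a) {x y : ℝ} (hx : 0 ≤ x) (hxy : x < y) :
    x / pf a x ≤ y / pf a y := by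
  have hp := pf_pos ha x
  have hq := pf_pos ha y
  rw [div_le_div_iff₀ hp hq]
  have hy : 0 ≤ y := by linarith
  refine abs_le_of_sq_le_sq' ?_ (mul_nonneg hy hp.le) |>.2
  rw [mul_pow, mul_pow, pf_sq, pf_sq, ← mul_div_assoc, ← mul_div_assoc]
  apply div_le_div_of_nonneg_right _ (by positivity)
  have : x ^ 2 ≤ y ^ 2 := by nlinarith
  nlinarith [mul_le_mul_of_nonneg_right this (sq_nonneg a)]

lemma exists_peak {a : ℝ} (ha : 0 < a) : ∃ x0 : ℝ, -1 < x0 ∧ x0 < 1 ∧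
    StrictMonoOn (hf a) (Set.Icc (-1) x0) ∧ StrictAntiOn (hf a) (Set.Icc x0 1) := by
  have hc : Continuous (fun x => 1 - x - x / pf a x) := by
    have := pf_cont a
    exact (by fun_prop : Continuous fun x : ℝ => 1 - x).sub
      (continuous_id.div this (fun x => (pf_pos ha x).ne'))
  have hp1 : pf a 1 = 1 := by
    have := pf_one a 1
    have hp := pf_pos ha 1
    have h2 : pf a 1 ^ 2 = 1 := by rw [pf_sq]; field_simp
    nlinarith
  have := intermediate_value_Ioo' (zero_le_one' ℝ) hc.continuousOn
  obtain ⟨x0, ⟨h0, h1⟩, hx0⟩ := this (show (0:ℝ) ∈ _ by simp [hp1])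
  simp only at hx0
  refine ⟨x0, by linarith, h1, ?_, ?_⟩
  · apply strictMonoOn_of_deriv_pos (convex_Icc _ _) (hf_cont ha).continuousOn
    intro x hx
    rw [interior_Icc] at hx
    rw [(hf_deriv ha x).deriv]
    have hp := pf_pos ha x
    have : 0 < 1 + x := by linarith [hx.1]
    refine mul_pos (by positivity) ?_
    rcases le_or_gt 0 x with h | h
    · have := ratio_mono ha h hx.2
      linarith [hx.2]
    · have : x / pf a x < 0 := div_neg_of_neg_of_pos h hp
      linarith
  · apply strictAntiOn_of_deriv_neg (convex_Icc _ _) (hf_cont ha).continuousOn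
    intro x hx
    rw [interior_Icc] at hx
    rw [(hf_deriv ha x).deriv]
    have hp := pf_pos ha x
    have : 0 < 1 + x := by linarith [hx.1]
    refine mul_neg_of_pos_of_neg (by positivity) ?_
    have := ratio_mono ha h0.le hx.1
    linarith [hx.1]

lemma hf_lt_kf {a : ℝ} (ha : 0 < a) {x : ℝ} (h1 : -1 < x) (h2 : x < 1) : hf a x < kf a x := by
  have e1 := kf_eq ha h1 h2
  have e2 := hf_eq ha x
  have hp := pf_pos ha x
  have hp1 := pf_lt_one ha h1 h2
  have hx : 0 < (1 + x) ^ 2 := pow_pos (by linarith) 2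
  have : hf a x < (1 + x) ^ 2 := by
    by_contra hc; push Not at hc
    nlinarith [mul_pos hx hp, mul_le_mul_of_nonneg_right hc (show 0 ≤ 1 + pf a x by linarith)]
  have : (1 + x) ^ 2 < kf a x := by
    by_contra hc; push Not at hc
    nlinarith [mul_pos hx hp, mul_le_mul_of_nonneg_right hc (show 0 ≤ 1 - pf a x by linarith)]
  linarith

lemma kf_exists {a : ℝ} (ha : 0 < a) {m : ℝ} (hm : 0 < m) :
    ∃ x, -1 < x ∧ x < 1 ∧ kf a x = m := by
  -- kf x ≥ (1+x)/(1-x)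
  have hb : m / (1 + m) < 1 := by rw [div_lt_one (by positivity)]; linarith
  have hb0 : 0 < m / (1 + m) := by positivity
  have hk : m < kf a (m / (1 + m)) := by
    unfold kf
    have hp := pf_pos ha (m / (1 + m))
    rw [lt_div_iff₀ (by linarith)]
    have : m * (1 - m / (1 + m)) = m / (1 + m) := by field_simp; ring
    rw [this]
    have h1 : 1 ≤ (1 + pf a (m / (1 + m))) ^ 2 := by nlinarith
    have h2 : (1 : ℝ) ≤ 1 + a ^ 2 := by nlinarith
    have h3 : 1 + m / (1 + m) ≤ (1 + a ^ 2) * (1 + m / (1 + m)) := by nlinarith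
    nlinarith
  have hk0 : kf a (-1) = 0 := by simp [kf]
  have := intermediate_value_Ioo (show (-1:ℝ) ≤ m / (1 + m) by linarith)
    ((kf_cont a).mono (fun x hx => ⟨hx.1, by linarith [hx.2]⟩))
  obtain ⟨x, hx, h⟩ := this (show m ∈ _ from ⟨by rw [hk0]; exact hm, hk⟩)
  exact ⟨x, hx.1, by linarith [hx.2], h⟩

lemma sol_lt {a μ y : ℝ} (hm : 0 < μ) (hy : 0 < y) (h : r a μ y = 0) :
    y < a / (a ^ 2 + 1) ∨ a = 0 := by
  by_cases ha : a = 0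
  · exact Or.inr ha
  left
  unfold r at h
  have : 0 < μ * a ^ 2 / (y ^ 2 + μ) ^ 2 := by positivity
  have h2 : a ^ 2 + 1 < a / y := by linarith
  rw [lt_div_iff₀ hy] at h2
  rw [lt_div_iff₀ (by positivity)]
  linarith

lemma key {a : ℝ} (ha : 0 < a) {μ : ℝ} (hm : 0 < μ) {K : ℝ} (hK : K = a / (2 * (a ^ 2 + 1)))
    {x : ℝ} (h1 : -1 < x) (h2 : x < 1) :
    r a μ (K * (1 + x)) = 0 ↔ (kf a x = μ / K ^ 2 ∨ hf a x = μ / K ^ 2) := by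
  have hK0 : 0 < K := by rw [hK]; positivity
  have hKe : 2 * (a ^ 2 + 1) * K = a := by rw [hK]; field_simp
  have hp := pf_pos ha x
  have hp1 := pf_lt_one ha h1 h2
  have e1 := kf_eq ha h1 h2
  have e2 := hf_eq ha x
  have h := pf_one a x
  have hx : 0 < 1 + x := by linarith
  obtain ⟨m, rfl⟩ : ∃ m, μ = m * K ^ 2 := ⟨μ / K ^ 2, by field_simp⟩
  rw [mul_div_cancel_right₀ _ (by positivity)]
  have hm0 : 0 < m := pos_of_mul_pos_left hm (by positivity)
  have e3 : r a (m * K ^ 2) (K * (1 + x)) = 0 ↔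
      (m * (1 - pf a x) - (1 + x) ^ 2 * (1 + pf a x)) *
      (m * (1 + pf a x) - (1 + x) ^ 2 * (1 - pf a x)) = 0 := by
    have e4 : r a (m * K ^ 2) (K * (1 + x)) =
        (a ^ 2 + 1) ^ 2 * ((m * (1 - pf a x) - (1 + x) ^ 2 * (1 + pf a x)) *
      (m * (1 + pf a x) - (1 + x) ^ 2 * (1 - pf a x))) / ((1 + x) ^ 2 * ((1 + x) ^ 2 + m) ^ 2) := by
      unfold r
      have ea : a / (K * (1 + x)) = 2 * (a ^ 2 + 1) / (1 + x) := by
        rw [div_eq_div_iff (by positivity) (by positivity)]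
        linear_combination (-(1 + x)) * hKe
      have eb : m * K ^ 2 * a ^ 2 / ((K * (1 + x)) ^ 2 + m * K ^ 2) ^ 2 =
          4 * (a ^ 2 + 1) ^ 2 * m / ((1 + x) ^ 2 + m) ^ 2 := by
        have : (K * (1 + x)) ^ 2 + m * K ^ 2 = K ^ 2 * ((1 + x) ^ 2 + m) := by ring
        rw [this, div_eq_div_iff (by positivity) (by positivity)]
        have : a ^ 2 = (2 * (a ^ 2 + 1) * K) ^ 2 := by rw [hKe]
        linear_combination (m * K ^ 2 * ((1 + x) ^ 2 + m) ^ 2) * this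
      rw [ea, eb]
      field_simp
      linear_combination (-((1 + x) ^ 2 + m) ^ 2) * h
    rw [e4, div_eq_zero_iff]
    have : ((1 + x) ^ 2 * ((1 + x) ^ 2 + m) ^ 2) ≠ 0 := by positivity
    have h3 : (a ^ 2 + 1) ^ 2 ≠ 0 := by positivity
    simp only [this, or_false, mul_eq_zero, h3, false_or]
  rw [e3, mul_eq_zero]
  have q1 : 1 - pf a x ≠ 0 := by linarith
  have q2 : 1 + pf a x ≠ 0 := by linarith
  rw [← e1, ← e2, ← sub_mul, ← sub_mul, mul_eq_zero, mul_eq_zero]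
  simp only [q1, q2, or_false, sub_eq_zero, eq_comm]

lemma ncard_red {a : ℝ} (ha : 0 < a) {μ : ℝ} (hm : 0 < μ) {K : ℝ}
    (hK : K = a / (2 * (a ^ 2 + 1))) :
    {y : ℝ | 0 < y ∧ r a μ y = 0}.ncard =
    {x : ℝ | -1 < x ∧ x < 1 ∧ (kf a x = μ / K ^ 2 ∨ hf a x = μ / K ^ 2)}.ncard := by
  have hK0 : 0 < K := by rw [hK]; positivity
  have : {y : ℝ | 0 < y ∧ r a μ y = 0} = (fun x => K * (1 + x)) ''
      {x : ℝ | -1 < x ∧ x < 1 ∧ (kf a x = μ / K ^ 2 ∨ hf a x = μ / K ^ 2)} := by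
    ext y
    constructor
    · rintro ⟨hy, hr⟩
      have hlt := (sol_lt hm hy hr).resolve_right ha.ne'
      have e : K * (1 + (y / K - 1)) = y := by field_simp; ring
      have l1 : -1 < y / K - 1 := by have : 0 < y / K := by positivity
                                     linarith
      have l2 : y / K - 1 < 1 := by
        have : y / K < 2 := by
          rw [div_lt_iff₀ hK0]
          have : 2 * K = a / (a ^ 2 + 1) := by rw [hK]; field_simp
          linarith
        linarith
      exact ⟨y / K - 1, ⟨l1, l2, (key ha hm hK l1 l2).1 (by rw [e]; exact hr)⟩, e⟩
    · rintro ⟨x, ⟨h1, h2, h3⟩, rfl⟩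
      exact ⟨mul_pos hK0 (by linarith), (key ha hm hK h1 h2).2 h3⟩
  rw [this, Set.ncard_image_of_injective]
  intro x y hxy
  have := mul_left_cancel₀ hK0.ne' hxy
  linarith

theorem stmt5 (a : ℝ) (ha : 0 < a) :
    ∃ τ : ℝ, 0 < τ ∧ τ < a ^ 2 / 4 ∧
      (∀ μ : ℝ, τ < μ → {y : ℝ | 0 < y ∧ r a μ y = 0}.ncard = 1) ∧
      {y : ℝ | 0 < y ∧ r a τ y = 0}.ncard = 2 ∧
      (∀ μ : ℝ, 0 < μ → μ < τ → {y : ℝ | 0 < y ∧ r a μ y = 0}.ncard = 3) ∧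
      (∀ μ : ℝ, 0 < μ → ∀ y : ℝ, 0 < y → r a μ y = 0 → y < a / (a ^ 2 + 1)) := by
  obtain ⟨x0, hx1, hx2, hmono, hanti⟩ := exists_peak ha
  obtain ⟨K, hK⟩ : ∃ K, K = a / (2 * (a ^ 2 + 1)) := ⟨_, rfl⟩
  have hK0 : 0 < K := by rw [hK]; positivity
  have hKe : 2 * (a ^ 2 + 1) * K = a := by rw [hK]; field_simp
  have hK2 : 0 < K ^ 2 := by positivity
  have hz1 : hf a (-1) = 0 := by simp [hf]
  have hz2 : hf a 1 = 0 := by simp [hf]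
  have hpos : 0 < hf a x0 := by
    rw [← hz1]
    exact hmono ⟨le_rfl, hx1.le⟩ ⟨hx1.le, le_rfl⟩ hx1
  have hl : ∀ x, -1 < x → x < 1 → x ≠ x0 → hf a x < hf a x0 := by
    intro x h1 h2 hne
    rcases lt_or_gt_of_ne hne with h | h
    · exact hmono ⟨h1.le, h.le⟩ ⟨hx1.le, le_rfl⟩ h
    · exact hanti ⟨le_rfl, hx2.le⟩ ⟨h.le, h2.le⟩ h
  have hle : ∀ x, -1 < x → x < 1 → hf a x ≤ hf a x0 := by
    intro x h1 h2
    by_cases h : x = x0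
    · rw [h]
    · exact (hl x h1 h2 h).le
  have kinj : ∀ x y, -1 < x → x < 1 → -1 < y → y < 1 → kf a x = kf a y → x = y := by
    intro x y h1 h2 h3 h4 h
    exact (kf_mono ha).injOn ⟨h1.le, h2⟩ ⟨h3.le, h4⟩ h
  refine ⟨K ^ 2 * hf a x0, by positivity, ?_, ?_, ?_, ?_, ?_⟩
  · have hp := pf_pos ha x0
    have hp1 := pf_lt_one ha hx1 hx2
    have hgt := abs_lt.mp (pf_gt ha hx1 hx2)
    have e2 := hf_eq ha x0
    have hlt : hf a x0 < 1 := by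
      by_contra hc; push Not at hc
      have : (1 + x0) ^ 2 ≤ (1 + pf a x0) ^ 2 := by
        apply pow_le_pow_left₀ <;> linarith
      have h3 := mul_le_mul_of_nonneg_right this (show 0 ≤ 1 - pf a x0 by linarith)
      have h4 : hf a x0 ≤ (1 + pf a x0) * (1 - pf a x0) := by
        apply le_of_mul_le_mul_right _ (show 0 < 1 + pf a x0 by linarith)
        nlinarith
      nlinarith
    have : K ≤ a / 2 := by nlinarith [mul_pos hK0 (pow_pos ha 2)]
    have : K ^ 2 ≤ (a / 2) ^ 2 := pow_le_pow_left₀ hK0.le this 2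
    nlinarith
  · intro μ hμ
    have hm : 0 < μ := lt_trans (by positivity) hμ
    rw [ncard_red ha hm hK]
    obtain ⟨x, h1, h2, h3⟩ := kf_exists ha (div_pos hm hK2)
    have hlt : hf a x0 < μ / K ^ 2 := by rw [lt_div_iff₀ hK2]; linarith
    rw [Set.ncard_eq_one]
    refine ⟨x, ?_⟩
    ext z
    simp only [Set.mem_ofPred_eq, Set.mem_singleton_iff]
    constructor
    · rintro ⟨g1, g2, g | g⟩
      · exact kinj _ _ g1 g2 h1 h2 (g.trans h3.symm)
      · linarith [hle z g1 g2]
    · rintro rfl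
      exact ⟨h1, h2, Or.inl h3⟩
  · have hm : 0 < K ^ 2 * hf a x0 := by positivity
    rw [ncard_red ha hm hK, mul_div_cancel_left₀ _ hK2.ne']
    obtain ⟨x, h1, h2, h3⟩ := kf_exists ha hpos
    rw [Set.ncard_eq_two]
    refine ⟨x, x0, ?_, ?_⟩
    · rintro rfl
      linarith [hf_lt_kf ha h1 h2]
    ext z
    simp only [Set.mem_ofPred_eq, Set.mem_singleton_iff, Set.mem_insert_iff]
    constructor
    · rintro ⟨g1, g2, g | g⟩
      · exact Or.inl (kinj _ _ g1 g2 h1 h2 (g.trans h3.symm))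
      · right
        by_contra hne
        linarith [hl z g1 g2 hne]
    · rintro (rfl | rfl)
      · exact ⟨h1, h2, Or.inl h3⟩
      · exact ⟨hx1, hx2, Or.inr rfl⟩
  · intro μ hm hμ
    rw [ncard_red ha hm hK]
    have hq := div_pos hm hK2
    obtain ⟨x, h1, h2, h3⟩ := kf_exists ha hq
    have hlt : μ / K ^ 2 < hf a x0 := by rw [div_lt_iff₀ hK2]; linarith
    generalize μ / K ^ 2 = q at *
    obtain ⟨u, ⟨u1, u2⟩, u3⟩ := intermediate_value_Ioo hx1.le (hf_cont ha).continuousOn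
      (show q ∈ _ from ⟨by rw [hz1]; exact hq, hlt⟩)
    obtain ⟨v, ⟨v1, v2⟩, v3⟩ := intermediate_value_Ioo' hx2.le (hf_cont ha).continuousOn
      (show q ∈ _ from ⟨by rw [hz2]; exact hq, hlt⟩)
    rw [Set.ncard_eq_three]
    refine ⟨x, u, v, ?_, ?_, ?_, ?_⟩
    · rintro rfl
      linarith [hf_lt_kf ha h1 h2]
    · rintro rfl
      linarith [hf_lt_kf ha h1 h2]
    · linarith
    ext z
    simp only [Set.mem_ofPred_eq, Set.mem_singleton_iff, Set.mem_insert_iff]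
    constructor
    · rintro ⟨g1, g2, g | g⟩
      · exact Or.inl (kinj _ _ g1 g2 h1 h2 (g.trans h3.symm))
      · right
        rcases le_total z x0 with h | h
        · exact Or.inl (hmono.injOn ⟨g1.le, h⟩ ⟨u1.le, u2.le⟩ (g.trans u3.symm))
        · exact Or.inr (hanti.injOn ⟨h, g2.le⟩ ⟨v1.le, v2.le⟩ (g.trans v3.symm))
    · rintro (rfl | rfl | rfl)
      · exact ⟨h1, h2, Or.inl h3⟩
      · exact ⟨u1, by linarith, Or.inr u3⟩
      · exact ⟨by linarith, v2, Or.inr v3⟩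
  · intro μ hm y hy h
    exact (sol_lt hm hy h).resolve_right ha.ne'
end

section
/- Let a > 0 and let τ ∈ (0, a²/4) be the unique zero of μ ↦ r(y_ub(μ); μ). For every 0 < μ < τ, the three solutions y*_μ < y**_μ < y***_μ of r(y;μ) = 0 satisfy y*_μ < y_lb(μ) < √μ < y**_μ < y_ub(μ) < y***_μ. Moreover, on (0, τ) the functions μ ↦ y*_μ and μ ↦ y**_μ are strictly increasing and μ ↦ y***_μ is strictly decreasing. -/
lemma r_deriv (a μ y : ℝ) (hμ : 0 < μ) (hy : 0 < y) :
    HasDerivAt (r a μ) (a * (4 * μ * a * y ^ 3 - (y ^ 2 + μ) ^ 3) / (y ^ 2 * (y ^ 2 + μ) ^ 3)) y := by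
  have h0 : y ^ 2 + μ ≠ 0 := by positivity
  have hd : HasDerivAt (fun y : ℝ => (y ^ 2 + μ) ^ 2) (2 * (y ^ 2 + μ) * (2 * y)) y := by
    have := (((hasDerivAt_id y).pow 2).add_const μ).pow 2
    refine HasDerivAt.congr_deriv this ?_
    simp
  have h1 := (((hasDerivAt_const y a).div (hasDerivAt_id y) hy.ne').sub
    ((hasDerivAt_const y (μ * a ^ 2)).div hd (by positivity))).sub_const (a ^ 2 + 1)
  have hy' := hy.ne'
  refine HasDerivAt.congr_deriv (f := r a μ) h1 ?_
  simp only [id, Pi.pow_apply]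
  field_simp
  ring

lemma sgn (a μ l u y : ℝ) (h1 : l * u = μ) (h2 : (l + u) ^ 3 = 4 * μ * a) :
    4 * μ * a * y ^ 3 - (y ^ 2 + μ) ^ 3 = ((l + u) * y) ^ 3 - ((l + u) * y + (y - l) * (y - u)) ^ 3 := by
  rw [mul_pow, h2, ← h1]; ring

lemma r_cont (a μ : ℝ) (hμ : 0 < μ) (s : Set ℝ) (hs : ∀ y ∈ s, 0 < y) : ContinuousOn (r a μ) s :=
  fun y hy => (r_deriv a μ y hμ (hs y hy)).continuousAt.continuousWithinAt

lemma anti1 (a μ l u : ℝ) (ha : 0 < a) (hl : 0 < l) (hu : l < u)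
    (h1 : l * u = μ) (h2 : (l + u) ^ 3 = 4 * μ * a) : StrictAntiOn (r a μ) (Set.Ioc 0 l) := by
  have hμ : 0 < μ := by rw [← h1]; exact mul_pos hl (hl.trans hu)
  refine strictAntiOn_of_deriv_neg (convex_Ioc _ _) (r_cont a μ hμ _ fun y hy => hy.1) ?_
  intro y hy
  rw [interior_Ioc] at hy
  have hy0 := hy.1
  rw [(r_deriv a μ y hμ hy.1).deriv, sgn a μ l u y h1 h2]
  apply div_neg_of_neg_of_pos _ (by positivity)
  apply mul_neg_of_pos_of_neg ha
  rw [sub_neg]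
  apply pow_lt_pow_left₀ _ (by have := hl.trans hu; positivity) (by norm_num)
  nlinarith [mul_pos_of_neg_of_neg (sub_neg.2 hy.2) (sub_neg.2 (hy.2.trans hu))]

lemma anti3 (a μ l u : ℝ) (ha : 0 < a) (hl : 0 < l) (hu : l < u)
    (h1 : l * u = μ) (h2 : (l + u) ^ 3 = 4 * μ * a) : StrictAntiOn (r a μ) (Set.Ici u) := by
  have hu0 := hl.trans hu
  have hμ : 0 < μ := by rw [← h1]; exact mul_pos hl (hl.trans hu)
  refine strictAntiOn_of_deriv_neg (convex_Ici _) (r_cont a μ hμ _ fun y hy => hu0.trans_le hy) ?_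
  intro y hy
  rw [interior_Ici] at hy
  have hyu : u < y := hy
  have hy0 : 0 < y := hu0.trans hy
  rw [(r_deriv a μ y hμ hy0).deriv, sgn a μ l u y h1 h2]
  apply div_neg_of_neg_of_pos _ (by positivity)
  apply mul_neg_of_pos_of_neg ha
  rw [sub_neg]
  apply pow_lt_pow_left₀ _ (by positivity) (by norm_num)
  nlinarith [mul_pos (sub_pos.2 hyu) (sub_pos.2 (hu.trans hyu))]

lemma mono2 (a μ l u : ℝ) (ha : 0 < a) (hl : 0 < l) (hu : l < u)
    (h1 : l * u = μ) (h2 : (l + u) ^ 3 = 4 * μ * a) : StrictMonoOn (r a μ) (Set.Icc l u) := by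
  have hu0 := hl.trans hu
  have hμ : 0 < μ := by rw [← h1]; exact mul_pos hl (hl.trans hu)
  refine strictMonoOn_of_deriv_pos (convex_Icc _ _) (r_cont a μ hμ _ fun y hy => hl.trans_le hy.1) ?_
  intro y hy
  rw [interior_Icc] at hy
  have hy0 : 0 < y := hl.trans hy.1
  rw [(r_deriv a μ y hμ hy0).deriv, sgn a μ l u y h1 h2]
  apply div_pos _ (by positivity)
  apply mul_pos ha
  rw [sub_pos]
  apply pow_lt_pow_left₀ _ _ (by norm_num)
  · nlinarith [mul_pos (sub_pos.2 hy.1) (sub_pos.2 hy.2)]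
  · have : (l + u) * y + (y - l) * (y - u) = y ^ 2 + l * u := by ring
    rw [this]; positivity

lemma bnds (a μ : ℝ) (ha : 0 < a) (hμ : 0 < μ) (h : μ < a ^ 2 / 4) :
    0 < ylb a μ ∧ ylb a μ < yub a μ ∧ ylb a μ * yub a μ = μ ∧
      (ylb a μ + yub a μ) ^ 3 = 4 * μ * a := by
  have hA : a ^ ((2 : ℝ) / 3) = (a ^ ((1 : ℝ) / 3)) ^ 2 := by
    rw [← Real.rpow_natCast, ← Real.rpow_mul ha.le]; norm_num
  have hA3 : (a ^ ((1 : ℝ) / 3)) ^ 3 = a := by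
    rw [← Real.rpow_natCast, ← Real.rpow_mul ha.le]; norm_num
  have hc3 : ((4 * μ) ^ ((1 : ℝ) / 3)) ^ 3 = 4 * μ := by
    rw [← Real.rpow_natCast, ← Real.rpow_mul (by positivity)]; norm_num
  have hA0 : 0 < a ^ ((1 : ℝ) / 3) := by positivity
  have hc0 : 0 < (4 * μ) ^ ((1 : ℝ) / 3) := by positivity
  unfold ylb yub
  rw [hA]
  generalize a ^ ((1 : ℝ) / 3) = A at *
  generalize (4 * μ) ^ ((1 : ℝ) / 3) = c at *
  have hlt : c < A ^ 2 := by
    apply lt_of_pow_lt_pow_left₀ 3 (by positivity)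
    rw [hc3, ← pow_mul, mul_comm 2 3, pow_mul, hA3]; linarith
  have hs0 : 0 < √(A ^ 2 - c) := Real.sqrt_pos.2 (by linarith)
  have hs2 : √(A ^ 2 - c) ^ 2 = A ^ 2 - c := Real.sq_sqrt (by linarith)
  generalize √(A ^ 2 - c) = s at *
  have hsA : s < A := by
    apply lt_of_pow_lt_pow_left₀ 2 hA0.le; linarith
  refine ⟨mul_pos (by positivity) (by linarith), ?_, ?_, ?_⟩
  · apply mul_lt_mul_of_pos_left _ (by positivity); linarith
  · linear_combination (-c ^ 2 / 4) * hs2 + hc3 / 4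
  · rw [show c / 2 * (A - s) + c / 2 * (A + s) = c * A by ring, mul_pow, hc3, hA3]

lemma r_sqrt (a μ : ℝ) (ha : 0 < a) (hμ : 0 < μ) : r a μ (√μ) < 0 := by
  have hs : 0 < √μ := Real.sqrt_pos.2 hμ
  have h2 : √μ ^ 2 = μ := Real.sq_sqrt hμ.le
  unfold r
  generalize √μ = s at *
  subst h2
  have : a / s - s ^ 2 * a ^ 2 / (s ^ 2 + s ^ 2) ^ 2 - (a ^ 2 + 1)
      = -((a / s / 2 - 1) ^ 2 + a ^ 2) := by
    field_simp; ring
  rw [this, neg_lt_zero]; positivity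

lemma r_mu (a μ ν y : ℝ) (ha : 0 < a) (hμ : 0 < μ) (h : μ < ν) (hy : 0 < y) :
    r a ν y - r a μ y = a ^ 2 * (ν - μ) * (μ * ν - y ^ 4) / ((y ^ 2 + μ) ^ 2 * (y ^ 2 + ν) ^ 2) := by
  have hν := hμ.trans h
  have h1 : y ^ 2 + μ ≠ 0 := by positivity
  have h2 : y ^ 2 + ν ≠ 0 := by positivity
  unfold r
  field_simp
  ring

lemma r_mu_lo (a μ ν y : ℝ) (ha : 0 < a) (hμ : 0 < μ) (h : μ < ν) (hy : 0 < y) (hy2 : y < √μ) :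
    r a μ y < r a ν y := by
  have hν := hμ.trans h
  have hsq : y ^ 2 < μ := (Real.lt_sqrt hy.le).1 hy2
  rw [← sub_pos, r_mu a μ ν y ha hμ h hy]
  apply div_pos _ (by positivity)
  apply mul_pos (mul_pos (by positivity) (by linarith))
  nlinarith [sq_nonneg y]

lemma r_mu_hi (a μ ν y : ℝ) (ha : 0 < a) (hμ : 0 < μ) (h : μ < ν) (hy : 0 < y) (hy2 : √ν < y) :
    r a ν y < r a μ y := by
  have hν := hμ.trans h
  have hsq : ν < y ^ 2 := (Real.sqrt_lt' hy).1 hy2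
  rw [← sub_neg, r_mu a μ ν y ha hμ h hy]
  apply div_neg_of_neg_of_pos _ (by positivity)
  apply mul_neg_of_pos_of_neg (mul_pos (by positivity) (by linarith))
  nlinarith [sq_nonneg y]

/-- let `τ ∈ (0, a²/4)` be the unique zero of `μ ↦ r(y_ub(μ); μ)`.
If `y₁ μ < y₂ μ < y₃ μ` are the three positive solutions of `r(·;μ) = 0` for
`μ ∈ (0, τ)`, then `y₁ μ < y_lb(μ) < √μ < y₂ μ < y_ub(μ) < y₃ μ`, and on `(0, τ)`
the maps `y₁, y₂` are strictly increasing while `y₃` is strictly decreasing. -/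
theorem stmt6 (a τ : ℝ) (ha : 0 < a)
    (hτ : τ ∈ Set.Ioo 0 (a ^ 2 / 4))
    (hτ0 : r a τ (yub a τ) = 0)
    (hτuniq : ∀ μ ∈ Set.Ioo 0 (a ^ 2 / 4), r a μ (yub a μ) = 0 → μ = τ)
    (y₁ y₂ y₃ : ℝ → ℝ)
    (hsol : ∀ μ ∈ Set.Ioo 0 τ,
      0 < y₁ μ ∧ y₁ μ < y₂ μ ∧ y₂ μ < y₃ μ ∧
      r a μ (y₁ μ) = 0 ∧ r a μ (y₂ μ) = 0 ∧ r a μ (y₃ μ) = 0 ∧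
      ∀ y : ℝ, 0 < y → r a μ y = 0 → y = y₁ μ ∨ y = y₂ μ ∨ y = y₃ μ) :
    (∀ μ ∈ Set.Ioo 0 τ,
      y₁ μ < ylb a μ ∧ ylb a μ < Real.sqrt μ ∧ Real.sqrt μ < y₂ μ ∧
      y₂ μ < yub a μ ∧ yub a μ < y₃ μ) ∧
    StrictMonoOn y₁ (Set.Ioo 0 τ) ∧
    StrictMonoOn y₂ (Set.Ioo 0 τ) ∧
    StrictAntiOn y₃ (Set.Ioo 0 τ) := by
  have key : ∀ μ ∈ Set.Ioo 0 τ,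
      y₁ μ < ylb a μ ∧ ylb a μ < Real.sqrt μ ∧ Real.sqrt μ < y₂ μ ∧
      y₂ μ < yub a μ ∧ yub a μ < y₃ μ := by
    intro μ hμ
    obtain ⟨hl, hlu, h1, h2⟩ := bnds a μ ha hμ.1 (hμ.2.trans hτ.2)
    obtain ⟨p1, p12, p23, z1, z2, z3, -⟩ := hsol μ hμ
    have A1 := anti1 a μ _ _ ha hl hlu h1 h2
    have A2 := mono2 a μ _ _ ha hl hlu h1 h2
    have A3 := anti3 a μ _ _ ha hl hlu h1 h2
    have hs := r_sqrt a μ ha hμ.1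
    have hls : ylb a μ < √μ := by
      apply Real.lt_sqrt_of_sq_lt; nlinarith
    have hsu : √μ < yub a μ := by
      rw [Real.sqrt_lt' (hl.trans hlu)]; nlinarith
    have a2 : ylb a μ < y₂ μ := by
      by_contra! hc
      have := A1 ⟨p1, p12.le.trans hc⟩ ⟨p1.trans p12, hc⟩ p12
      linarith
    have b2 : y₂ μ < yub a μ := by
      by_contra! hc
      have := A3 (Set.mem_Ici.2 hc) (Set.mem_Ici.2 (hc.trans p23.le)) p23
      linarith
    refine ⟨?_, hls, ?_, b2, ?_⟩
    · by_contra! hc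
      have := A2 ⟨hc, p12.le.trans b2.le⟩ ⟨a2.le, b2.le⟩ p12
      linarith
    · by_contra! hc
      have := A2.monotoneOn ⟨a2.le, b2.le⟩ ⟨hls.le, hsu.le⟩ hc
      linarith
    · by_contra! hc
      have := A2 ⟨a2.le, b2.le⟩ ⟨a2.le.trans p23.le, hc⟩ p23
      linarith
  refine ⟨key, ?_, ?_, ?_⟩
  · intro μ hμ ν hν hlt
    obtain ⟨hl, hlu, h1, h2⟩ := bnds a ν ha hν.1 (hν.2.trans hτ.2)
    obtain ⟨p1, -, -, z1, -, -, -⟩ := hsol μ hμ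
    obtain ⟨q1, -, -, w1, -, -, -⟩ := hsol ν hν
    obtain ⟨k1, k2, -, -, -⟩ := key μ hμ
    obtain ⟨m1, m2, m3, m4, -⟩ := key ν hν
    have hr := r_mu_lo a μ ν _ ha hμ.1 hlt p1 (k1.trans k2)
    have hss := Real.sqrt_lt_sqrt hμ.1.le hlt
    by_contra! hc
    rcases le_total (y₁ μ) (ylb a ν) with h | h
    · have := (anti1 a ν _ _ ha hl hlu h1 h2).antitoneOn ⟨q1, m1.le⟩ ⟨p1, h⟩ hc
      linarith
    · have := (mono2 a ν _ _ ha hl hlu h1 h2).monotoneOn ⟨h, by linarith⟩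
        ⟨m2.le, by linarith⟩ ((k1.trans k2).trans hss).le
      have := r_sqrt a ν ha hν.1
      linarith
  · intro μ hμ ν hν hlt
    obtain ⟨hl, hlu, h1, h2⟩ := bnds a μ ha hμ.1 (hμ.2.trans hτ.2)
    obtain ⟨-, -, -, -, z2, -, -⟩ := hsol μ hμ
    obtain ⟨q1, q2, -, -, w2, -, -⟩ := hsol ν hν
    obtain ⟨k1, k2, k3, k4, -⟩ := key μ hμ
    obtain ⟨m1, m2, m3, m4, -⟩ := key ν hν
    have hr := r_mu_hi a μ ν _ ha hμ.1 hlt (q1.trans q2) m3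
    have hss := Real.sqrt_lt_sqrt hμ.1.le hlt
    by_contra! hc
    have := (mono2 a μ _ _ ha hl hlu h1 h2).monotoneOn
      ⟨by linarith, by linarith⟩ ⟨by linarith, k4.le⟩ hc
    linarith
  · intro μ hμ ν hν hlt
    obtain ⟨hl, hlu, h1, h2⟩ := bnds a μ ha hμ.1 (hμ.2.trans hτ.2)
    obtain ⟨-, -, -, -, -, z3, -⟩ := hsol μ hμ
    obtain ⟨q1, q2, q3, -, -, w3, -⟩ := hsol ν hν
    obtain ⟨k1, k2, k3, k4, k5⟩ := key μ hμ
    obtain ⟨m1, m2, m3, m4, m5⟩ := key ν hν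
    have hr := r_mu_hi a μ ν _ ha hμ.1 hlt ((q1.trans q2).trans q3) (m3.trans q3)
    by_contra! hc
    have := (anti3 a μ _ _ ha hl hlu h1 h2).antitoneOn
      (Set.mem_Ici.2 k5.le) (Set.mem_Ici.2 (k5.le.trans hc)) hc
    linarith
end

section
/- Let a > 0. If 0 < μ < (a(√(a²+1) − a)/(2(a²+1)))² or μ > (a(√(a²+1) + a)/(2(a²+1)))², then t(√(μ(a²+1)); μ) < 0. -/
/-- `t(x; μ) = a/x - μ a² / (μ(a²+1) + x²)² - 1`. -/
noncomputable def t (a μ x : ℝ) : ℝ :=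
  a / x - μ * a ^ 2 / (μ * (a ^ 2 + 1) + x ^ 2) ^ 2 - 1

/-- if `0 < μ < (a(√(a²+1) - a)/(2(a²+1)))²` or
`μ > (a(√(a²+1) + a)/(2(a²+1)))²`, then `t(√(μ(a²+1)); μ) < 0`. -/
theorem stmt9 (a μ : ℝ) (ha : 0 < a) (hμ : 0 < μ)
    (h : μ < (a * (Real.sqrt (a ^ 2 + 1) - a) / (2 * (a ^ 2 + 1))) ^ 2 ∨
      (a * (Real.sqrt (a ^ 2 + 1) + a) / (2 * (a ^ 2 + 1))) ^ 2 < μ) :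
    t a μ (Real.sqrt (μ * (a ^ 2 + 1))) < 0 := by
  obtain ⟨m, hm, rfl⟩ : ∃ m : ℝ, 0 < m ∧ m ^ 2 = μ :=
    ⟨Real.sqrt μ, Real.sqrt_pos.mpr hμ, Real.sq_sqrt hμ.le⟩
  obtain ⟨s, hs, hs2, hse⟩ : ∃ s : ℝ, 0 < s ∧ s ^ 2 = a ^ 2 + 1 ∧ Real.sqrt (a ^ 2 + 1) = s :=
    ⟨Real.sqrt (a ^ 2 + 1), Real.sqrt_pos.mpr (by positivity), Real.sq_sqrt (by positivity), rfl⟩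
  rw [hse, ← hs2] at h
  have hx : Real.sqrt (m ^ 2 * (a ^ 2 + 1)) = m * s := by
    rw [← hs2, ← mul_pow]
    exact Real.sqrt_sq (by positivity)
  have hsa : a < s := by nlinarith
  have key : 0 < (2 * s ^ 2 * m - a * (s - a)) * (2 * s ^ 2 * m - a * (s + a)) := by
    have h2 : 0 < 2 * s ^ 2 := by positivity
    have h0 : a * (s - a) < a * (s + a) := by nlinarith
    rcases h with h | h
    · have h1 : m < a * (s - a) / (2 * s ^ 2) :=
        lt_of_pow_lt_pow_left₀ 2
          (div_nonneg (mul_nonneg ha.le (sub_pos.mpr hsa).le) h2.le) h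
      rw [lt_div_iff₀ h2] at h1
      exact mul_pos_of_neg_of_neg (by linarith) (by linarith)
    · have h1 : a * (s + a) / (2 * s ^ 2) < m :=
        lt_of_pow_lt_pow_left₀ 2 hm.le h
      rw [div_lt_iff₀ h2] at h1
      exact mul_pos (by linarith) (by linarith)
  have e : t a (m ^ 2) (m * s) =
      -((2 * s ^ 2 * m - a * (s - a)) * (2 * s ^ 2 * m - a * (s + a))) / (4 * m ^ 2 * s ^ 4) := by
    have e1 : (2 * s ^ 2 * m - a * (s - a)) * (2 * s ^ 2 * m - a * (s + a))
        = 4 * s ^ 4 * m ^ 2 - 4 * a * s ^ 3 * m + a ^ 2 := by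
      linear_combination a ^ 2 * hs2
    rw [e1]
    unfold t
    rw [← hs2, show m ^ 2 * s ^ 2 + (m * s) ^ 2 = 2 * m ^ 2 * s ^ 2 by ring]
    field_simp
    ring
  rw [hx, e]
  exact div_neg_of_neg_of_pos (by linarith) (by positivity)
end

section
/- Let a > 0. If μ > a²/(4(a²+1)³) then ∂t/∂x (x;μ) < 0 for all x > 0. If 0 < μ ≤ a²/(4(a²+1)³) then ∂t/∂x (x;μ) > 0 for x_lb(μ) < x < x_ub(μ) and ∂t/∂x (x;μ) ≤ 0 for all other x > 0; moreover x_lb(μ) ≤ √(μ(a²+1)) ≤ x_ub(μ). -/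
/-- `x_lb(μ) = ((4μa)^{1/3}/2)(1 - √(1 - (4μ)^{1/3}(a²+1)/a^{2/3}))`. -/
noncomputable def xlb (a μ : ℝ) : ℝ :=
  (4 * μ * a) ^ ((1 : ℝ) / 3) / 2 *
    (1 - Real.sqrt (1 - (4 * μ) ^ ((1 : ℝ) / 3) * (a ^ 2 + 1) / a ^ ((2 : ℝ) / 3)))

/-- `x_ub(μ) = ((4μa)^{1/3}/2)(1 + √(1 - (4μ)^{1/3}(a²+1)/a^{2/3}))`. -/
noncomputable def xub (a μ : ℝ) : ℝ :=
  (4 * μ * a) ^ ((1 : ℝ) / 3) / 2 *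
    (1 + Real.sqrt (1 - (4 * μ) ^ ((1 : ℝ) / 3) * (a ^ 2 + 1) / a ^ ((2 : ℝ) / 3)))

theorem t_deriv_aux (a μ x c : ℝ) (ha : 0 < a) (hμ : 0 < μ) (hx : 0 < x)
    (hc : c ^ 3 = 4 * μ * a) :
    deriv (fun x : ℝ => t a μ x) x =
      a / (x ^ 2 * (μ * (a ^ 2 + 1) + x ^ 2) ^ 3) *
        ((c * x) ^ 3 - (μ * (a ^ 2 + 1) + x ^ 2) ^ 3) := by
  have hB : 0 < μ * (a ^ 2 + 1) + x ^ 2 := by positivity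
  have h1 : HasDerivAt (fun x : ℝ => (μ * (a ^ 2 + 1) + x ^ 2) ^ 2)
      (2 * (μ * (a ^ 2 + 1) + x ^ 2) * (2 * x)) x := by
    have := (((hasDerivAt_id x).pow 2).const_add (μ * (a ^ 2 + 1))).pow 2
    refine this.congr_deriv ?_
    simp
  have h2 := (((hasDerivAt_const x a).div (hasDerivAt_id x) hx.ne').sub
    ((hasDerivAt_const x (μ * a ^ 2)).div h1 (by positivity))).sub_const 1
  have h3 : HasDerivAt (fun x : ℝ => t a μ x) _ x := h2
  rw [h3.deriv, mul_pow, hc]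
  simp only [id]
  field_simp
  ring

theorem aux_sign (a μ x c : ℝ) (ha : 0 < a) (hμ : 0 < μ) (hx : 0 < x)
    (hc : c ^ 3 = 4 * μ * a) :
    (0 < deriv (fun x : ℝ => t a μ x) x ↔ μ * (a ^ 2 + 1) + x ^ 2 < c * x) ∧
    (deriv (fun x : ℝ => t a μ x) x < 0 ↔ c * x < μ * (a ^ 2 + 1) + x ^ 2) := by
  rw [t_deriv_aux a μ x c ha hμ hx hc]
  have hB : 0 < μ * (a ^ 2 + 1) + x ^ 2 := by positivity
  have hq : 0 < a / (x ^ 2 * (μ * (a ^ 2 + 1) + x ^ 2) ^ 3) := by positivity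
  have ho : Odd 3 := by decide
  constructor
  · rw [mul_pos_iff_of_pos_left hq, sub_pos, ho.strictMono_pow.lt_iff_lt]
  · rw [← neg_pos, ← mul_neg, mul_pos_iff_of_pos_left hq, neg_pos, sub_neg, ho.strictMono_pow.lt_iff_lt]

/-- sign of `∂t/∂x`: for `μ > a²/(4(a²+1)³)` it is negative on `(0,∞)`;
for `0 < μ ≤ a²/(4(a²+1)³)` it is positive exactly on `(x_lb, x_ub)` and nonpositive
elsewhere on `(0,∞)`; moreover `x_lb ≤ √(μ(a²+1)) ≤ x_ub`. -/
theorem stmt10 (a μ : ℝ) (ha : 0 < a) (hμ : 0 < μ) :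
    (a ^ 2 / (4 * (a ^ 2 + 1) ^ 3) < μ →
      ∀ x : ℝ, 0 < x → deriv (fun x : ℝ => t a μ x) x < 0) ∧
    (μ ≤ a ^ 2 / (4 * (a ^ 2 + 1) ^ 3) →
      (∀ x : ℝ, xlb a μ < x → x < xub a μ → 0 < deriv (fun x : ℝ => t a μ x) x) ∧
      (∀ x : ℝ, 0 < x → (x ≤ xlb a μ ∨ xub a μ ≤ x) →
        deriv (fun x : ℝ => t a μ x) x ≤ 0) ∧
      xlb a μ ≤ Real.sqrt (μ * (a ^ 2 + 1)) ∧
      Real.sqrt (μ * (a ^ 2 + 1)) ≤ xub a μ) := by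
  obtain ⟨m, hm, hm3, hmr⟩ : ∃ m : ℝ, 0 < m ∧ m ^ 3 = 4 * μ ∧ (4 * μ) ^ ((1 : ℝ) / 3) = m :=
    ⟨(4 * μ) ^ ((1 : ℝ) / 3), by positivity, by
      rw [← Real.rpow_natCast, ← Real.rpow_mul (by positivity)]; norm_num, rfl⟩
  obtain ⟨b, hb, hb3, hbr⟩ : ∃ b : ℝ, 0 < b ∧ b ^ 3 = a ∧ a ^ ((1 : ℝ) / 3) = b :=
    ⟨a ^ ((1 : ℝ) / 3), by positivity, by
      rw [← Real.rpow_natCast, ← Real.rpow_mul (by positivity)]; norm_num, rfl⟩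
  have hb2 : a ^ ((2 : ℝ) / 3) = b ^ 2 := by
    rw [← hbr, ← Real.rpow_natCast, ← Real.rpow_mul (by positivity)]; norm_num
  have hcr : (4 * μ * a) ^ ((1 : ℝ) / 3) = m * b := by
    rw [Real.mul_rpow (by positivity) ha.le, hmr, hbr]
  have hc3 : (m * b) ^ 3 = 4 * μ * a := by rw [mul_pow, hm3, hb3]
  have hsign := fun x hx => aux_sign a μ x (m * b) ha hμ hx hc3
  obtain ⟨K, hK⟩ : ∃ K, K = a ^ 2 + 1 := ⟨_, rfl⟩
  have hK0 : 0 < K := by rw [hK]; positivity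
  unfold xlb xub
  rw [hcr, hmr, hb2]
  rw [← hK] at hsign ⊢
  have hμm : μ = m ^ 3 / 4 := by linarith
  have hab : a ^ 2 = (b ^ 2) ^ 3 := by rw [← hb3]; ring
  refine ⟨fun h x hx => (hsign x hx).2.2 ?_, fun h => ?_⟩
  · rw [div_lt_iff₀ (by positivity)] at h
    have h' : (b ^ 2) ^ 3 < (m * K) ^ 3 := by
      rw [← hab, mul_pow, hm3]; linarith
    have h2 : b ^ 2 < m * K := lt_of_pow_lt_pow_left₀ 3 (by positivity) h'
    have h3 : m ^ 2 * b ^ 2 < m ^ 2 * (m * K) := by gcongr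
    rw [hμm]
    nlinarith [sq_nonneg (x - m * b / 2)]
  · rw [le_div_iff₀ (by positivity)] at h
    have h' : (m * K) ^ 3 ≤ (b ^ 2) ^ 3 := by
      rw [← hab, mul_pow, hm3]; linarith
    have h2 : m * K ≤ b ^ 2 := le_of_pow_le_pow_left₀ (by norm_num) (by positivity) h'
    have hD : 0 ≤ 1 - m * K / b ^ 2 := by
      rw [sub_nonneg, div_le_one (by positivity)]; exact h2
    have hD1 : 1 - m * K / b ^ 2 < 1 := by
      have : 0 < m * K / b ^ 2 := by positivity
      linarith
    obtain ⟨s, hs⟩ : ∃ s, s = Real.sqrt (1 - m * K / b ^ 2) := ⟨_, rfl⟩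
    have hs0 : 0 ≤ s := by rw [hs]; positivity
    have hs2 : s ^ 2 = 1 - m * K / b ^ 2 := by rw [hs, Real.sq_sqrt hD]
    have hs1 : s < 1 := by nlinarith
    rw [← hs]
    obtain ⟨l, hl⟩ : ∃ l, l = m * b / 2 * (1 - s) := ⟨_, rfl⟩
    obtain ⟨u, hu⟩ : ∃ u, u = m * b / 2 * (1 + s) := ⟨_, rfl⟩
    rw [← hl, ← hu]
    have hl0 : 0 < l := by
      rw [hl]; exact mul_pos (by positivity) (by linarith)
    have hlu : l ≤ u := by
      rw [hl, hu]; exact mul_le_mul_of_nonneg_left (by linarith) (by positivity)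
    have hsum : l + u = m * b := by rw [hl, hu]; ring
    have hprod : l * u = μ * K := by
      have : l * u = m ^ 2 * b ^ 2 / 4 * (1 - s ^ 2) := by rw [hl, hu]; ring
      rw [this, hs2, hμm]; field_simp; ring
    rw [← hsum, ← hprod] at hsign
    rw [← hprod]
    refine ⟨fun x h1 h2 => (hsign x (hl0.trans h1)).1.2 ?_, fun x hx h1 => ?_, ?_, ?_⟩
    · nlinarith [mul_pos (sub_pos.2 h1) (sub_pos.2 h2)]
    · rw [← not_lt, (hsign x hx).1, not_lt]
      rcases h1 with h1 | h1
      · nlinarith [mul_nonneg (sub_nonneg.2 h1) (sub_nonneg.2 (h1.trans hlu))]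
      · nlinarith [mul_nonneg (sub_nonneg.2 h1) (sub_nonneg.2 (hlu.trans h1))]
    · apply Real.le_sqrt_of_sq_le
      rw [sq]; exact mul_le_mul_of_nonneg_left hlu hl0.le
    · exact Real.sqrt_le_iff.2 ⟨hl0.le.trans hlu, by
        rw [sq]; exact mul_le_mul_of_nonneg_right hlu (hl0.le.trans hlu)⟩
end

section
/- Let a > 0 and define q(μ) = t(x_lb(μ); μ) for 0 < μ < a²/(4(a²+1)³). Then q is strictly increasing on this interval, q(μ) < 0 as μ → 0⁺, q(μ) > 0 as μ → (a²/(4(a²+1)³))⁻, and q has a unique zero τ in (0, a²/(4(a²+1)³)); in particular τ < a²/(4(a²+1)³) ≤ 1/27. -/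
open Filter Topology

/-- `q(μ) = t(x_lb(μ); μ)`. -/
noncomputable def qfun (a μ : ℝ) : ℝ := t a μ (xlb a μ)

noncomputable def rr (a μ : ℝ) : ℝ :=
  Real.sqrt (1 - (4 * μ) ^ ((1 : ℝ) / 3) * (a ^ 2 + 1) / a ^ ((2 : ℝ) / 3))

noncomputable def gg (r : ℝ) : ℝ := 1 - r ^ 3 * (2 - r) / ((1 - r) ^ 3 * (1 + r))

lemma gg_anti {r p : ℝ} (hr : 0 ≤ r) (hrp : r < p) (hp : p < 1) : gg p < gg r := by
  unfold gg
  have h1 : r ^ 3 * (2 - r) < p ^ 3 * (2 - p) := by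
    have h2 : r ^ 2 ≤ p ^ 2 := by nlinarith
    have h3 : r * (2 - r) < p * (2 - p) := by nlinarith
    have h4 : 0 ≤ r * (2 - r) := by nlinarith
    have h5 : 0 < p ^ 2 := by nlinarith
    calc r ^ 3 * (2 - r) = r ^ 2 * (r * (2 - r)) := by ring
      _ ≤ p ^ 2 * (r * (2 - r)) := by gcongr
      _ < p ^ 2 * (p * (2 - p)) := by gcongr
      _ = p ^ 3 * (2 - p) := by ring
  have hpos : 0 < (1 - p) ^ 3 * (1 + p) := by
    have : 0 < 1 - p := by linarith
    have : 0 < 1 + p := by linarith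
    positivity
  have h2 : (1 - p) ^ 3 * (1 + p) ≤ (1 - r) ^ 3 * (1 + r) := by
    have e1 : (1 - p) ^ 2 ≤ (1 - r) ^ 2 := by nlinarith
    have e2 : (1 - p ^ 2) ≤ 1 - r ^ 2 := by nlinarith
    have e3 : 0 ≤ 1 - p ^ 2 := by nlinarith
    calc (1 - p) ^ 3 * (1 + p) = (1 - p) ^ 2 * (1 - p ^ 2) := by ring
      _ ≤ (1 - r) ^ 2 * (1 - r ^ 2) := by gcongr
      _ = _ := by ring
  have h3 : 0 ≤ r ^ 3 * (2 - r) := mul_nonneg (by positivity) (by linarith)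
  have : r ^ 3 * (2 - r) / ((1 - r) ^ 3 * (1 + r)) < p ^ 3 * (2 - p) / ((1 - p) ^ 3 * (1 + p)) := by
    apply div_lt_div₀ h1 h2 (h3.trans h1.le) hpos
  linarith

lemma rr_cont (a : ℝ) (ha : 0 < a) : Continuous (rr a) := by
  have hx : Continuous fun μ : ℝ => (4 * μ) ^ ((1 : ℝ) / 3) :=
    (Real.continuous_rpow_const (by norm_num)).comp (by fun_prop)
  unfold rr
  fun_prop

lemma s_cube {μ : ℝ} (h : 0 ≤ μ) : ((4 * μ) ^ ((1 : ℝ) / 3)) ^ 3 = 4 * μ := by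
  rw [← Real.rpow_natCast, ← Real.rpow_mul (by positivity)]; norm_num

lemma b_two {a : ℝ} (h : 0 < a) : a ^ ((2 : ℝ) / 3) = (a ^ ((1 : ℝ) / 3)) ^ 2 := by
  rw [← Real.rpow_natCast, ← Real.rpow_mul h.le]; norm_num

lemma b_cube {a : ℝ} (h : 0 < a) : (a ^ ((1 : ℝ) / 3)) ^ 3 = a := by
  rw [← Real.rpow_natCast, ← Real.rpow_mul h.le]; norm_num

lemma s_le (a : ℝ) (ha : 0 < a) {μ : ℝ} (h0 : 0 < μ) (h : μ < a ^ 2 / (4 * (a ^ 2 + 1) ^ 3)) :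
    (4 * μ) ^ ((1 : ℝ) / 3) * (a ^ 2 + 1) / a ^ ((2 : ℝ) / 3) < 1 := by
  have hb : 0 < a ^ ((1 : ℝ) / 3) := by positivity
  rw [b_two ha, div_lt_one (by positivity)]
  apply lt_of_pow_lt_pow_left₀ 3 (by positivity)
  rw [mul_pow, s_cube h0.le, ← pow_mul, mul_comm 2 3, pow_mul, b_cube ha]
  rw [lt_div_iff₀ (by positivity)] at h
  linarith

lemma rr_end (a : ℝ) (ha : 0 < a) : rr a (a ^ 2 / (4 * (a ^ 2 + 1) ^ 3)) = 0 := by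
  have hb : 0 < a ^ ((1 : ℝ) / 3) := by positivity
  unfold rr
  have : (4 * (a ^ 2 / (4 * (a ^ 2 + 1) ^ 3))) ^ ((1 : ℝ) / 3) * (a ^ 2 + 1) = a ^ ((2 : ℝ) / 3) := by
    rw [b_two ha]
    refine (pow_left_inj₀ (by positivity) (by positivity) (n := 3) (by norm_num)).1 ?_
    rw [mul_pow, s_cube (by positivity), ← pow_mul, mul_comm 2 3, pow_mul, b_cube ha]
    field_simp
  rw [this, div_self (by positivity)]
  simp

lemma rr_zero (a : ℝ) : rr a 0 = 1 := by
  unfold rr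
  simp

lemma rr_anti (a : ℝ) (ha : 0 < a) {μ ν : ℝ} (h0 : 0 ≤ μ) (hlt : μ < ν)
    (h : ν < a ^ 2 / (4 * (a ^ 2 + 1) ^ 3)) : rr a ν < rr a μ := by
  have := s_le a ha (h0.trans_lt hlt) h
  unfold rr
  apply Real.sqrt_lt_sqrt (by linarith)
  have : (4 * μ) ^ ((1 : ℝ) / 3) < (4 * ν) ^ ((1 : ℝ) / 3) :=
    Real.rpow_lt_rpow (by positivity) (by linarith) (by norm_num)
  gcongr

lemma rr_lt_one (a : ℝ) (ha : 0 < a) {μ : ℝ} (h0 : 0 < μ)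
    (h : μ < a ^ 2 / (4 * (a ^ 2 + 1) ^ 3)) : rr a μ < 1 := by
  have := rr_anti a ha le_rfl h0 h
  rwa [rr_zero] at this

lemma q_eq (a : ℝ) (ha : 0 < a) {μ : ℝ} (h0 : 0 < μ) (h : μ < a ^ 2 / (4 * (a ^ 2 + 1) ^ 3)) :
    qfun a μ = (a ^ 2 + 1) * gg (rr a μ) - 1 := by
  have hr1 := rr_lt_one a ha h0 h
  have hr0 : 0 ≤ rr a μ := Real.sqrt_nonneg _
  have hsq : rr a μ ^ 2 = 1 - (4 * μ) ^ ((1 : ℝ) / 3) * (a ^ 2 + 1) / a ^ ((2 : ℝ) / 3) :=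
    Real.sq_sqrt (by linarith [s_le a ha h0 h])
  have hx : xlb a μ = (4 * μ) ^ ((1 : ℝ) / 3) * a ^ ((1 : ℝ) / 3) / 2 * (1 - rr a μ) := by
    unfold xlb rr
    rw [Real.mul_rpow (by positivity) ha.le]
  have hs3 := s_cube h0.le
  have hb3 := b_cube ha
  have hb0 : 0 < a ^ ((1 : ℝ) / 3) := by positivity
  have hs0 : 0 < (4 * μ) ^ ((1 : ℝ) / 3) := by positivity
  rw [b_two ha] at hsq
  unfold qfun t
  rw [hx]
  generalize rr a μ = r at *
  generalize (4 * μ) ^ ((1 : ℝ) / 3) = s at *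
  generalize a ^ ((1 : ℝ) / 3) = b at *
  have hu : 0 < 1 - r := by linarith
  have hv : 0 < 1 + r := by linarith
  have hA : a ^ 2 + 1 = b ^ 2 * (1 - r ^ 2) / s := by
    rw [hsq]; field_simp; ring
  have hmu : μ = s ^ 3 / 4 := by linarith
  have hden : μ * (a ^ 2 + 1) + (s * b / 2 * (1 - r)) ^ 2 = s ^ 2 * b ^ 2 * (1 - r) / 2 := by
    rw [hA, hmu]; field_simp; ring
  rw [hden, hA, hmu, ← hb3]
  unfold gg
  have : 1 - r ^ 2 = (1 - r) * (1 + r) := by ring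
  rw [this]
  field_simp
  ring

/-- `q` is strictly increasing on `(0, a²/(4(a²+1)³))`, `q(μ) < 0` as
`μ → 0⁺`, `q(μ) > 0` as `μ → (a²/(4(a²+1)³))⁻`, `q` has a unique zero `τ` in this
interval, and `a²/(4(a²+1)³) ≤ 1/27`. -/
theorem stmt11 (a : ℝ) (ha : 0 < a) :
    StrictMonoOn (qfun a) (Set.Ioo 0 (a ^ 2 / (4 * (a ^ 2 + 1) ^ 3))) ∧
    (∀ᶠ μ in 𝓝[>] (0 : ℝ), qfun a μ < 0) ∧
    (∀ᶠ μ in 𝓝[<] (a ^ 2 / (4 * (a ^ 2 + 1) ^ 3)), 0 < qfun a μ) ∧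
    (∃! τ : ℝ, τ ∈ Set.Ioo 0 (a ^ 2 / (4 * (a ^ 2 + 1) ^ 3)) ∧ qfun a τ = 0) ∧
    a ^ 2 / (4 * (a ^ 2 + 1) ^ 3) ≤ 1 / 27 := by
  have hM : 0 < a ^ 2 / (4 * (a ^ 2 + 1) ^ 3) := by positivity
  have hgc : ∀ μ, rr a μ < 1 → ContinuousAt (fun μ => (a ^ 2 + 1) * gg (rr a μ) - 1) μ := by
    intro μ h
    have hr0 : 0 ≤ rr a μ := Real.sqrt_nonneg _
    have hc : ContinuousAt (rr a) μ := (rr_cont a ha).continuousAt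
    have hne : (1 - rr a μ) ^ 3 * (1 + rr a μ) ≠ 0 := by
      have : 0 < 1 - rr a μ := by linarith
      positivity
    unfold gg
    fun_prop (disch := exact hne)
  have hmono : StrictMonoOn (qfun a) (Set.Ioo 0 (a ^ 2 / (4 * (a ^ 2 + 1) ^ 3))) := by
    intro μ hμ ν hν hlt
    rw [q_eq a ha hμ.1 hμ.2, q_eq a ha hν.1 hν.2]
    have := gg_anti (Real.sqrt_nonneg _) (rr_anti a ha hμ.1.le hlt hν.2) (rr_lt_one a ha hμ.1 hμ.2)
    have hA : 0 < a ^ 2 + 1 := by positivity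
    have := mul_lt_mul_of_pos_left this hA
    unfold rr at *
    linarith
  have hneg : ∀ᶠ μ in 𝓝[>] (0 : ℝ), qfun a μ < 0 := by
    have h1 : ∀ᶠ μ in 𝓝 (0 : ℝ), 1 / 2 < rr a μ := by
      apply (rr_cont a ha).continuousAt.eventually_const_lt
      rw [rr_zero]; norm_num
    filter_upwards [nhdsWithin_le_nhds h1, Ioo_mem_nhdsGT hM] with μ h hμ
    rw [q_eq a ha hμ.1 hμ.2]
    have := gg_anti (by norm_num) h (rr_lt_one a ha hμ.1 hμ.2)
    have e : gg (1 / 2) = 0 := by unfold gg; norm_num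
    rw [e] at this
    nlinarith [sq_nonneg a]
  have hpos : ∀ᶠ μ in 𝓝[<] (a ^ 2 / (4 * (a ^ 2 + 1) ^ 3)), 0 < qfun a μ := by
    have h1 : ∀ᶠ μ in 𝓝 (a ^ 2 / (4 * (a ^ 2 + 1) ^ 3)), 0 < (a ^ 2 + 1) * gg (rr a μ) - 1 := by
      apply (hgc _ (by rw [rr_end a ha]; norm_num)).eventually_const_lt
      beta_reduce; rw [rr_end a ha]
      have e : gg 0 = 1 := by unfold gg; norm_num
      rw [e]
      nlinarith
    filter_upwards [nhdsWithin_le_nhds h1, Ioo_mem_nhdsLT hM] with μ h hμ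
    rwa [q_eq a ha hμ.1 hμ.2]
  refine ⟨hmono, hneg, hpos, ?_, ?_⟩
  · obtain ⟨x, hx, hxm⟩ := (hneg.and (Ioo_mem_nhdsGT hM)).exists
    obtain ⟨y, hy, hym⟩ := (hpos.and (Ioo_mem_nhdsLT hM)).exists
    have hcont : ContinuousOn (qfun a) (Set.Ioo 0 (a ^ 2 / (4 * (a ^ 2 + 1) ^ 3))) := by
      have : ContinuousOn (fun μ => (a ^ 2 + 1) * gg (rr a μ) - 1)
          (Set.Ioo 0 (a ^ 2 / (4 * (a ^ 2 + 1) ^ 3))) := fun μ hμ =>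
        (hgc μ (rr_lt_one a ha hμ.1 hμ.2)).continuousWithinAt
      exact this.congr fun μ hμ => q_eq a ha hμ.1 hμ.2
    obtain ⟨τ, hτ, h0⟩ := isPreconnected_Ioo.intermediate_value hxm hym hcont ⟨hx.le, hy.le⟩
    exact ⟨τ, ⟨hτ, h0⟩, fun z hz => hmono.injOn hz.1 hτ (hz.2.trans h0.symm)⟩
  · rw [div_le_div_iff₀ (by positivity) (by norm_num)]
    nlinarith [mul_nonneg (sq_nonneg (2 * a ^ 2 - 1)) (by positivity : (0:ℝ) ≤ a ^ 2 + 4)]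
end

section
/- Let a > 0 and let τ > 0 be the threshold below which the equation t(x;μ) = 0 has exactly three solutions x***_μ < x**_μ < x*_μ in (0, a). Then for every 0 < μ < τ one has x**_μ ≤ a(√(a²+1) − a)/(2√(a²+1)), and for every μ > 0 the largest solution x*_μ of t(x;μ) = 0 satisfies x*_μ ≥ a(√(a²+1) + a)/(2√(a²+1)). In particular sup_{0<μ<τ} x**_μ < inf_{μ>0} x*_μ. -/
lemma t_zero_iff (a μ x : ℝ) (hμ : 0 < μ) (hx : 0 < x) :
    t a μ x = 0 ↔ (a - x) * (μ * (a ^ 2 + 1) + x ^ 2) ^ 2 = μ * a ^ 2 * x := by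
  have h : 0 < μ * (a ^ 2 + 1) + x ^ 2 := by positivity
  have e : t a μ x = ((a - x) * (μ * (a ^ 2 + 1) + x ^ 2) ^ 2 - μ * a ^ 2 * x) /
      (x * (μ * (a ^ 2 + 1) + x ^ 2) ^ 2) := by
    unfold t
    field_simp
    ring
  rw [e, div_eq_zero_iff]
  have : x * (μ * (a ^ 2 + 1) + x ^ 2) ^ 2 ≠ 0 := by positivity
  simp [this, sub_eq_zero]

lemma M_ge (x d M : ℝ) (hx : 0 < x) (hd : 0 < d) (hdx : d ≤ x)
    (h : d * (M + x ^ 2) ^ 2 ≤ M * (x + d) ^ 2 * x) : x * d ≤ M := by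
  by_contra hc
  push Not at hc
  have h1 : (x ^ 3 - d * M) * (x * d - M) ≤ 0 := by nlinarith
  have h2 : 0 < x ^ 3 - d * M := by
    have h3 : d * M < d * (x * d) := mul_lt_mul_of_pos_left hc hd
    have h4 : d * d ≤ x * x := mul_le_mul hdx hdx hd.le hx.le
    nlinarith
  have := mul_pos h2 (sub_pos.2 hc)
  linarith

lemma uniq (a x y M k : ℝ) (hx : 0 < x) (hxy : x < y) (hya : y < a) (hax : a ≤ 2 * x)
    (hM : 0 < M) (hk : k ≤ M * a ^ 2)
    (h1 : (a - x) * (M + x ^ 2) ^ 2 = k * x) (h2 : (a - y) * (M + y ^ 2) ^ 2 = k * y) :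
    False := by
  obtain ⟨d, rfl⟩ : ∃ d, a = x + d := ⟨a - x, by ring⟩
  have hd : 0 < d := by linarith
  have hdx : d ≤ x := by linarith
  have hy : 0 < y := hx.trans hxy
  have hMd : x * d ≤ M := by
    apply M_ge x d M hx hd hdx
    have := mul_le_mul_of_nonneg_right hk hx.le
    have e : x + d - x = d := by ring
    rw [e] at h1
    linarith
  have key : (y - x) * (x * y * (x + y) * (2 * M + x ^ 2 + y ^ 2)
      - (x + d) * (x * y * (x ^ 2 + x * y + y ^ 2) + 2 * M * x * y - M ^ 2)) = 0 := by
    linear_combination y * h1 - x * h2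
  have key2 : x * y * (x + y) * (2 * M + x ^ 2 + y ^ 2)
      - (x + d) * (x * y * (x ^ 2 + x * y + y ^ 2) + 2 * M * x * y - M ^ 2) = 0 := by
    rcases mul_eq_zero.1 key with h | h
    · linarith
    · exact h
  obtain ⟨n, rfl⟩ : ∃ n, M = x * d + n := ⟨M - x * d, by ring⟩
  have hn : 0 ≤ n := by linarith
  obtain ⟨f, rfl⟩ : ∃ f, x = d + f := ⟨x - d, by ring⟩
  obtain ⟨e, rfl⟩ : ∃ e, y = d + f + e := ⟨y - (d + f), by ring⟩
  have hf : 0 ≤ f := by linarith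
  have he : 0 < e := by linarith
  ring_nf at key2
  exact absurd key2 (ne_of_gt (by positivity))

/-- with `xstar μ` the largest positive solution of `t(·;μ) = 0`
(for every `μ > 0`) and, for `0 < μ < τ`, `xss μ` the middle one of the three
solutions in `(0, a)`, one has `xss μ ≤ a(√(a²+1) - a)/(2√(a²+1))` for `0 < μ < τ`
and `xstar μ ≥ a(√(a²+1) + a)/(2√(a²+1))` for every `μ > 0`; in particular every
`xss μ` (with `0 < μ < τ`) is below every `xstar μ'` (with `μ' > 0`). -/
theorem stmt12 (a τ : ℝ) (ha : 0 < a) (hτpos : 0 < τ)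
    (xstar xss : ℝ → ℝ)
    (hxstar : ∀ μ : ℝ, 0 < μ →
      0 < xstar μ ∧ xstar μ < a ∧ t a μ (xstar μ) = 0 ∧
      ∀ x : ℝ, 0 < x → t a μ x = 0 → x ≤ xstar μ)
    (hthree : ∀ μ ∈ Set.Ioo 0 τ, ∃ x₃ : ℝ,
      0 < x₃ ∧ x₃ < xss μ ∧ xss μ < xstar μ ∧
      t a μ x₃ = 0 ∧ t a μ (xss μ) = 0 ∧
      ∀ x : ℝ, 0 < x → t a μ x = 0 → x = x₃ ∨ x = xss μ ∨ x = xstar μ) :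
    (∀ μ ∈ Set.Ioo 0 τ,
      xss μ ≤ a * (Real.sqrt (a ^ 2 + 1) - a) / (2 * Real.sqrt (a ^ 2 + 1))) ∧
    (∀ μ : ℝ, 0 < μ →
      a * (Real.sqrt (a ^ 2 + 1) + a) / (2 * Real.sqrt (a ^ 2 + 1)) ≤ xstar μ) ∧
    (∀ μ ∈ Set.Ioo 0 τ, ∀ μ' : ℝ, 0 < μ' → xss μ < xstar μ') := by
  have hs : 0 < Real.sqrt (a ^ 2 + 1) := by positivity
  have hs2 : Real.sqrt (a ^ 2 + 1) ^ 2 = a ^ 2 + 1 := Real.sq_sqrt (by positivity)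
  set s := Real.sqrt (a ^ 2 + 1) with hsdef
  have has : a < s := by nlinarith
  set p := a * (s + a) / (2 * s) with hp
  set q := a * (s - a) / (2 * s) with hq
  have hpq : p + q = a := by rw [hp, hq]; field_simp; ring
  have hpq2 : 4 * (a ^ 2 + 1) * (p * q) = a ^ 2 := by
    have : 4 * s ^ 2 * (p * q) = a ^ 2 * (s ^ 2 - a ^ 2) := by
      rw [hp, hq]; field_simp; ring
    rw [hs2] at this
    linarith
  have hq0 : 0 < q := by
    have : 0 < s - a := by linarith
    positivity
  have hp0 : 0 < p := by positivity
  have hqp : q < p := by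
    rw [hp, hq]
    gcongr
    linarith
  have part2 : ∀ μ : ℝ, 0 < μ → p ≤ xstar μ := by
    intro μ hμ
    obtain ⟨-, -, -, h⟩ := hxstar μ hμ
    let P : ℝ → ℝ := fun x => (a - x) * (μ * (a ^ 2 + 1) + x ^ 2) ^ 2 - μ * a ^ 2 * x
    have hc : ContinuousOn P (Set.Icc p a) := by
      apply Continuous.continuousOn
      fun_prop
    have hpa : p ≤ a := by linarith
    have h0 : (0:ℝ) ∈ Set.Icc (P a) (P p) := by
      constructor
      · simp only [P, sub_self, zero_mul, zero_sub]
        have : 0 < μ * a ^ 2 * a := by positivity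
        linarith
      · simp only [P]
        have e : a - p = q := by linarith
        rw [e]
        have h1 := mul_nonneg hq0.le (sq_nonneg (μ * (a ^ 2 + 1) - p ^ 2))
        have h2 : 4 * (a ^ 2 + 1) * (p * q) * (μ * p) = a ^ 2 * (μ * p) := by rw [hpq2]
        nlinarith
    obtain ⟨x, hx, hx0⟩ := intermediate_value_Icc' hpa hc h0
    have hxp : 0 < x := lt_of_lt_of_le hp0 hx.1
    refine hx.1.trans (h x hxp ((t_zero_iff a μ x hμ hxp).2 ?_))
    simp only [P] at hx0
    linarith
  have part1 : ∀ μ ∈ Set.Ioo 0 τ, xss μ ≤ q := by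
    intro μ hμ
    obtain ⟨x₃, h30, h3, hlt, -, hz, -⟩ := hthree μ hμ
    have hμ0 := hμ.1
    obtain ⟨hX0, hXa, hXz, -⟩ := hxstar μ hμ0
    have hx0 : 0 < xss μ := h30.trans h3
    rw [t_zero_iff a μ _ hμ0 hx0] at hz
    rw [t_zero_iff a μ _ hμ0 hX0] at hXz
    generalize xss μ = x at *
    generalize xstar μ = y at *
    by_contra hc
    push Not at hc
    have hxp : p ≤ x := by
      by_contra hc2
      push Not at hc2
      have h1 : 0 < (x - q) * (p - x) := mul_pos (by linarith) (by linarith)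
      have h2 : p * q < x * (a - x) := by rw [← hpq]; nlinarith
      have h3 : a ^ 2 < 4 * (a ^ 2 + 1) * (x * (a - x)) := by
        have h6 : 4 * (a ^ 2 + 1) * (p * q) < 4 * (a ^ 2 + 1) * (x * (a - x)) :=
          mul_lt_mul_of_pos_left h2 (by positivity)
        linarith
      have h4 := mul_lt_mul_of_pos_right h3 (mul_pos hμ0 hx0)
      have h5 := mul_nonneg (show 0 ≤ a - x by linarith) (sq_nonneg (μ * (a ^ 2 + 1) - x ^ 2))
      nlinarith
    refine uniq a x y (μ * (a ^ 2 + 1)) (μ * a ^ 2) hx0 hlt hXa (by linarith) (by positivity) ?_ hz hXz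
    nlinarith [mul_pos hμ0 (pow_pos ha 4)]
  exact ⟨part1, part2, fun μ hμ μ' hμ' =>
    (part1 μ hμ).trans_lt (hqp.trans_le (part2 μ' hμ'))⟩
end

section
/- Let a > 0, set c = 32/a², and let 0 < μ < 1/(2c). Then t(a(1 − cμ); μ) > 0, i.e. a/(a(1−cμ)) − μa²/(μ(a²+1) + a²(1−cμ)²)² − 1 > 0. -/
/-- for `a > 0`, `c = 32/a²` and `0 < μ < 1/(2c)`, one has
`t(a(1 - cμ); μ) > 0`, i.e.
`a/(a(1-cμ)) - μa²/(μ(a²+1) + a²(1-cμ)²)² - 1 > 0`. -/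
theorem stmt13 (a μ c : ℝ) (ha : 0 < a) (hc : c = 32 / a ^ 2)
    (hμ : 0 < μ) (hμ' : μ < 1 / (2 * c)) :
    0 < t a μ (a * (1 - c * μ)) ∧
    0 < a / (a * (1 - c * μ)) -
        μ * a ^ 2 / (μ * (a ^ 2 + 1) + a ^ 2 * (1 - c * μ) ^ 2) ^ 2 - 1 := by
  have hc0 : 0 < c := by rw [hc]; positivity
  have hca : c * a ^ 2 = 32 := by rw [hc]; field_simp
  have hs0 : 0 < c * μ := by positivity
  have hs : c * μ < 1 / 2 := by
    rw [lt_div_iff₀ (by positivity)] at hμ'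
    linarith
  have key : 0 < a / (a * (1 - c * μ)) -
        μ * a ^ 2 / (μ * (a ^ 2 + 1) + a ^ 2 * (1 - c * μ) ^ 2) ^ 2 - 1 := by
    have h1 : 1 + c * μ < a / (a * (1 - c * μ)) := by
      rw [lt_div_iff₀ (mul_pos ha (by linarith))]
      have : 0 < a * (c * μ) ^ 2 := by positivity
      nlinarith
    have hD : a ^ 2 / 4 ≤ μ * (a ^ 2 + 1) + a ^ 2 * (1 - c * μ) ^ 2 := by
      have h2 : (1 / 4 : ℝ) ≤ (1 - c * μ) ^ 2 := by nlinarith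
      have h3 : a ^ 2 * (1 / 4) ≤ a ^ 2 * (1 - c * μ) ^ 2 := by gcongr
      have h4 : 0 < μ * (a ^ 2 + 1) := by positivity
      linarith
    have hpos : 0 < a ^ 2 / 4 := by positivity
    have hD2 : (a ^ 2 / 4) ^ 2 ≤ (μ * (a ^ 2 + 1) + a ^ 2 * (1 - c * μ) ^ 2) ^ 2 := by
      gcongr
    have h5 : μ * a ^ 2 / (μ * (a ^ 2 + 1) + a ^ 2 * (1 - c * μ) ^ 2) ^ 2 ≤ c * μ := by
      rw [div_le_iff₀ (pow_pos (lt_of_lt_of_le hpos hD) 2)]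
      have h6 := mul_le_mul_of_nonneg_left hD2 hs0.le
      have h7 : c * μ * (a ^ 2 / 4) ^ 2 = 2 * (μ * a ^ 2) := by
        linear_combination (μ * a ^ 2 / 16) * hca
      have h8 : 0 < μ * a ^ 2 := by positivity
      linarith
    linarith
  refine ⟨?_, key⟩
  unfold t
  rw [mul_pow]
  exact key
end

section
/- Let a > 0, set c = 32(a²+1)³/a², and let 0 < μ < 1/(2c). Then r((a/(a²+1))(1 − cμ); μ) > 0; in fact r((a/(a²+1))(1 − cμ); μ) ≥ 16(a²+1)⁴ μ / a² > 0. -/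
/-- for `a > 0`, `c = 32(a²+1)³/a²` and `0 < μ < 1/(2c)`, one has
`r((a/(a²+1))(1 - cμ); μ) ≥ 16(a²+1)⁴ μ / a² > 0`. -/
theorem stmt14 (a μ c : ℝ) (ha : 0 < a) (hc : c = 32 * (a ^ 2 + 1) ^ 3 / a ^ 2)
    (hμ : 0 < μ) (hμ' : μ < 1 / (2 * c)) :
    16 * (a ^ 2 + 1) ^ 4 * μ / a ^ 2 ≤ r a μ (a / (a ^ 2 + 1) * (1 - c * μ)) ∧
    0 < r a μ (a / (a ^ 2 + 1) * (1 - c * μ)) := by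
  have hS : 0 < a ^ 2 + 1 := by positivity
  have hcpos : 0 < c := by rw [hc]; positivity
  have hcm : c * μ < 1 / 2 := by
    rw [lt_div_iff₀ (by positivity)] at hμ'
    linarith
  have hcm0 : 0 < c * μ := by positivity
  have hpos : 0 < 16 * (a ^ 2 + 1) ^ 4 * μ / a ^ 2 := by positivity
  suffices h : 16 * (a ^ 2 + 1) ^ 4 * μ / a ^ 2 ≤ r a μ (a / (a ^ 2 + 1) * (1 - c * μ)) from
    ⟨h, lt_of_lt_of_le hpos h⟩
  have ht : 0 < 1 - c * μ := by linarith
  have h1 : (a ^ 2 + 1) * (1 + c * μ) ≤ a / (a / (a ^ 2 + 1) * (1 - c * μ)) := by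
    have e : a / (a / (a ^ 2 + 1) * (1 - c * μ)) = (a ^ 2 + 1) / (1 - c * μ) := by
      field_simp
    rw [e, le_div_iff₀ ht]
    nlinarith [mul_pos hS (mul_pos hcm0 hcm0)]
  have hScm : (a ^ 2 + 1) * (c * μ) = 2 * (16 * (a ^ 2 + 1) ^ 4 * μ / a ^ 2) := by
    rw [hc]; field_simp; ring
  have hy : a / (a ^ 2 + 1) * (1 / 2) ≤ a / (a ^ 2 + 1) * (1 - c * μ) := by
    apply mul_le_mul_of_nonneg_left _ (by positivity)
    linarith
  have h2 : μ * a ^ 2 / ((a / (a ^ 2 + 1) * (1 - c * μ)) ^ 2 + μ) ^ 2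
      ≤ 16 * (a ^ 2 + 1) ^ 4 * μ / a ^ 2 := by
    have e : 16 * (a ^ 2 + 1) ^ 4 * μ / a ^ 2
        = μ * a ^ 2 / ((a / (a ^ 2 + 1) * (1 / 2)) ^ 2) ^ 2 := by
      field_simp; norm_num
    rw [e]
    apply div_le_div_of_nonneg_left (by positivity) (by positivity)
    apply pow_le_pow_left₀ (by positivity)
    have := pow_le_pow_left₀ (by positivity) hy 2
    linarith
  unfold r
  linarith
end

section
/- Let a > 0 and let τ ∈ (0, a²/4) be the unique zero of μ ↦ r(y_ub(μ); μ). For 0 < μ < τ, let (x*_μ, y*_μ), (x**_μ, y**_μ), (x***_μ, y***_μ) be the three solutions of ∇g_μ(x,y) = 0 with x, y > 0 (ordered with x***_μ < x**_μ < x*_μ). Then the Hessian ∇²g_μ is positive definite at (x*_μ, y*_μ) and at (x***_μ, y***_μ), so both are strict local minima of g_μ, while at (x**_μ, y**_μ) the Hessian has positive trace and strictly negative determinant, so it is a saddle point of g_μ. -/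
open Filter Topology

/-- `g_μ(x, y) = (μ/2)((1 - a y)² + y² + (a - x)² + 1) + x² y² / 2`. -/
noncomputable def g (a μ : ℝ) (q : ℝ × ℝ) : ℝ :=
  μ / 2 * ((1 - a * q.2) ^ 2 + q.2 ^ 2 + (a - q.1) ^ 2 + 1) + q.1 ^ 2 * q.2 ^ 2 / 2

/-- The Hessian of `g_μ` at `(x, y)`:
`[[μ + y², 2xy], [2xy, μ(a²+1) + x²]]`. -/
noncomputable def hess (a μ : ℝ) (q : ℝ × ℝ) : Matrix (Fin 2) (Fin 2) ℝ :=
  !![μ + q.2 ^ 2, 2 * q.1 * q.2; 2 * q.1 * q.2, μ * (a ^ 2 + 1) + q.1 ^ 2]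

lemma crit_eqs (a μ : ℝ) (p : ℝ × ℝ) (h : fderiv ℝ (g a μ) p = 0) :
    μ * (p.1 - a) + p.1 * p.2 ^ 2 = 0 ∧
    p.2 * (μ * (a ^ 2 + 1) + p.1 ^ 2) = μ * a := by
  have hd : DifferentiableAt ℝ (g a μ) p := by
    unfold g
    fun_prop
  have hf : HasFDerivAt (g a μ) (0 : ℝ × ℝ →L[ℝ] ℝ) p := h ▸ hd.hasFDerivAt
  constructor
  · have hl : HasDerivAt (fun t : ℝ => (t, p.2)) ((1 : ℝ), (0 : ℝ)) p.1 :=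
      (hasDerivAt_id p.1).prodMk (hasDerivAt_const p.1 p.2)
    have h1 := HasFDerivAt.comp_hasDerivAt (f := fun t : ℝ => (t, p.2)) p.1 hf hl
    have h2 : HasDerivAt (fun t : ℝ => μ / 2 * ((1 - a * p.2) ^ 2 + p.2 ^ 2 + (a - t) ^ 2 + 1)
        + t ^ 2 * p.2 ^ 2 / 2) (μ * (p.1 - a) + p.1 * p.2 ^ 2) p.1 := by
      have e1 := ((((hasDerivAt_id p.1).const_sub a).pow 2).const_add
        ((1 - a * p.2) ^ 2 + p.2 ^ 2)).add_const 1 |>.const_mul (μ / 2)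
      have e2 := (((hasDerivAt_id p.1).pow 2).mul_const (p.2 ^ 2)).div_const 2
      refine (e1.add e2).congr_deriv ?_
      simp
      ring
    simpa using h2.unique h1
  · have hl : HasDerivAt (fun t : ℝ => (p.1, t)) ((0 : ℝ), (1 : ℝ)) p.2 :=
      (hasDerivAt_const p.2 p.1).prodMk (hasDerivAt_id p.2)
    have h1 := HasFDerivAt.comp_hasDerivAt (f := fun t : ℝ => (p.1, t)) p.2 hf hl
    have h2 : HasDerivAt (fun t : ℝ => μ / 2 * ((1 - a * t) ^ 2 + t ^ 2 + (a - p.1) ^ 2 + 1)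
        + p.1 ^ 2 * t ^ 2 / 2) (p.2 * (μ * (a ^ 2 + 1) + p.1 ^ 2) - μ * a) p.2 := by
      have e1 := ((((((hasDerivAt_id p.2).const_mul a).const_sub 1).pow 2).add
        ((hasDerivAt_id p.2).pow 2)).add_const ((a - p.1) ^ 2)).add_const 1 |>.const_mul (μ / 2)
      have e2 := (((hasDerivAt_id p.2).pow 2).const_mul (p.1 ^ 2)).div_const 2
      refine (e1.add e2).congr_deriv ?_
      simp
      ring
    have h3 : p.2 * (μ * (a ^ 2 + 1) + p.1 ^ 2) - μ * a = 0 := by simpa using h2.unique h1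
    linarith

lemma expand (a μ : ℝ) (p q : ℝ × ℝ)
    (h1 : μ * (p.1 - a) + p.1 * p.2 ^ 2 = 0)
    (h2 : p.2 * (μ * (a ^ 2 + 1) + p.1 ^ 2) = μ * a) :
    g a μ q - g a μ p =
      ((μ + p.2 ^ 2) * (q.1 - p.1) ^ 2 + 2 * (2 * p.1 * p.2) * (q.1 - p.1) * (q.2 - p.2)
        + (μ * (a ^ 2 + 1) + p.1 ^ 2) * (q.2 - p.2) ^ 2) / 2
      + (q.1 - p.1) * (q.2 - p.2) * (p.1 * (q.2 - p.2) + p.2 * (q.1 - p.1))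
      + (q.1 - p.1) ^ 2 * (q.2 - p.2) ^ 2 / 2 := by
  unfold g
  linear_combination (q.1 - p.1) * h1 + (q.2 - p.2) * h2

lemma strict_min (a μ : ℝ) (hμ : 0 < μ) (p : ℝ × ℝ)
    (h1 : μ * (p.1 - a) + p.1 * p.2 ^ 2 = 0)
    (h2 : p.2 * (μ * (a ^ 2 + 1) + p.1 ^ 2) = μ * a)
    (hD : 0 < (μ + p.2 ^ 2) * (μ * (a ^ 2 + 1) + p.1 ^ 2) - (2 * p.1 * p.2) ^ 2) :
    ∀ᶠ q in 𝓝[≠] p, g a μ p < g a μ q := by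
  have hA : 0 < μ + p.2 ^ 2 := by positivity
  have hC : 0 < μ * (a ^ 2 + 1) + p.1 ^ 2 := by positivity
  have hexp := fun q => expand a μ p q h1 h2
  generalize μ + p.2 ^ 2 = A at *
  generalize μ * (a ^ 2 + 1) + p.1 ^ 2 = C at *
  generalize 2 * p.1 * p.2 = B at *
  obtain ⟨ε, hε⟩ : ∃ ε, ε = (A * C - B ^ 2) / (A + C) := ⟨_, rfl⟩
  have hε0 : 0 < ε := by rw [hε]; positivity
  have hεe : ε * (A + C) = A * C - B ^ 2 := by rw [hε]; field_simp
  have hAe : 0 < A - ε := by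
    have : 0 < (A - ε) * (A + C) := by nlinarith [sq_nonneg B, sq_pos_of_pos hA]
    exact pos_of_mul_pos_left this (by positivity)
  have hq : ∀ u v : ℝ, ε * (u ^ 2 + v ^ 2) ≤ A * u ^ 2 + 2 * B * u * v + C * v ^ 2 := by
    intro u v
    have : 0 ≤ (A - ε) * (A * u ^ 2 + 2 * B * u * v + C * v ^ 2 - ε * (u ^ 2 + v ^ 2)) := by
      have e : (A - ε) * (A * u ^ 2 + 2 * B * u * v + C * v ^ 2 - ε * (u ^ 2 + v ^ 2))
        = ((A - ε) * u + B * v) ^ 2 + (ε * v) ^ 2 := by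
        linear_combination (-v ^ 2) * hεe
      rw [e]; positivity
    have := nonneg_of_mul_nonneg_right this hAe
    linarith
  have hc : ContinuousAt (fun q : ℝ × ℝ => |p.1 * (q.2 - p.2) + p.2 * (q.1 - p.1)|) p := by
    fun_prop
  have hs : ∀ᶠ q in 𝓝 p, |p.1 * (q.2 - p.2) + p.2 * (q.1 - p.1)| < ε := by
    apply hc.eventually_lt continuousAt_const
    simpa using hε0
  filter_upwards [nhdsWithin_le_nhds hs, self_mem_nhdsWithin] with q hq1 hne
  have hn : 0 < (q.1 - p.1) ^ 2 + (q.2 - p.2) ^ 2 := by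
    by_contra hcon
    apply hne
    have z1 : q.1 - p.1 = 0 := by nlinarith [sq_nonneg (q.1 - p.1), sq_nonneg (q.2 - p.2)]
    have z2 : q.2 - p.2 = 0 := by nlinarith [sq_nonneg (q.1 - p.1), sq_nonneg (q.2 - p.2)]
    exact Prod.ext (by linarith) (by linarith)
  have e := hexp q
  have hb := hq (q.1 - p.1) (q.2 - p.2)
  generalize q.1 - p.1 = u at *
  generalize q.2 - p.2 = v at *
  generalize p.1 * v + p.2 * u = w at *
  have hw := abs_lt.mp hq1
  have k : 0 < ε * (u ^ 2 + v ^ 2) / 2 + u * v * w := by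
    rcases lt_or_ge 0 (u * v) with h | h
    · nlinarith [sq_nonneg (u - v), mul_pos h (by linarith : 0 < w + ε),
        mul_nonneg hε0.le (sq_nonneg (u - v))]
    · rcases h.lt_or_eq with h | h
      · nlinarith [mul_pos_of_neg_of_neg h (by linarith : w - ε < 0),
          mul_nonneg hε0.le (sq_nonneg (u + v))]
      · rw [h]; nlinarith [mul_pos hε0 hn]
  have : 0 ≤ u ^ 2 * v ^ 2 := by positivity
  linarith

lemma saddle (a μ : ℝ) (hμ : 0 < μ) (p : ℝ × ℝ)
    (h1 : μ * (p.1 - a) + p.1 * p.2 ^ 2 = 0)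
    (h2 : p.2 * (μ * (a ^ 2 + 1) + p.1 ^ 2) = μ * a)
    (hD : (μ + p.2 ^ 2) * (μ * (a ^ 2 + 1) + p.1 ^ 2) - (2 * p.1 * p.2) ^ 2 < 0) :
    ¬ IsLocalMin (g a μ) p ∧ ¬ IsLocalMax (g a μ) p := by
  have hA : 0 < μ + p.2 ^ 2 := by positivity
  have hexp := fun q => expand a μ p q h1 h2
  generalize μ + p.2 ^ 2 = A at *
  generalize μ * (a ^ 2 + 1) + p.1 ^ 2 = C at *
  generalize 2 * p.1 * p.2 = B at *
  constructor
  · intro hm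
    have hc : Tendsto (fun t : ℝ => (p.1 + t * (-B), p.2 + t * A)) (𝓝 0) (𝓝 p) := by
      have : Continuous (fun t : ℝ => (p.1 + t * (-B), p.2 + t * A)) := by fun_prop
      simpa using this.tendsto 0
    have hm' := hc.eventually hm
    have hcn : ContinuousAt (fun t : ℝ => A * (A * C - B ^ 2) / 2
      + t * ((-B) * A * (p.1 * A + p.2 * (-B))) + t ^ 2 * (B ^ 2 * A ^ 2 / 2)) 0 := by fun_prop
    have hs := hcn.eventually_lt (continuousAt_const (y := (0 : ℝ))) (by
      simp only [zero_mul, add_zero, ne_eq, OfNat.ofNat_ne_zero, not_false_eq_true, zero_pow]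
      have := mul_neg_of_pos_of_neg hA hD
      linarith)
    have hb : ∀ᶠ t in 𝓝[≠] (0 : ℝ), False := by
      filter_upwards [nhdsWithin_le_nhds hm', nhdsWithin_le_nhds hs, self_mem_nhdsWithin]
        with t ht1 ht2 ht
      have e := hexp (p.1 + t * (-B), p.2 + t * A)
      have ht0 : 0 < t ^ 2 := by
        have : t ≠ 0 := ht
        positivity
      have := mul_neg_of_pos_of_neg ht0 ht2
      simp only at e
      nlinarith
    exact hb.exists.elim fun _ h => h
  · intro hm
    have hc : Tendsto (fun t : ℝ => (p.1 + t, p.2)) (𝓝 0) (𝓝 p) := by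
      have : Continuous (fun t : ℝ => (p.1 + t, p.2)) := by fun_prop
      simpa using this.tendsto 0
    have hm' := hc.eventually hm
    have hb : ∀ᶠ t in 𝓝[≠] (0 : ℝ), False := by
      filter_upwards [nhdsWithin_le_nhds hm', self_mem_nhdsWithin] with t ht1 ht
      have e := hexp (p.1 + t, p.2)
      have ht0 : 0 < t ^ 2 := by
        have : t ≠ 0 := ht
        positivity
      have := mul_pos hA ht0
      simp only at e
      nlinarith
    exact hb.exists.elim fun _ h => h

lemma quintic (a μ x y : ℝ) (hμ : 0 < μ)
    (h1 : μ * (x - a) + x * y ^ 2 = 0)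
    (h2 : y * (μ * (a ^ 2 + 1) + x ^ 2) = μ * a) :
    (x - a) * (x ^ 2 + μ * (a ^ 2 + 1)) ^ 2 + μ * a ^ 2 * x = 0 := by
  have : μ * ((x - a) * (x ^ 2 + μ * (a ^ 2 + 1)) ^ 2 + μ * a ^ 2 * x) = 0 := by
    linear_combination (x ^ 2 + μ * (a ^ 2 + 1)) ^ 2 * h1
      - x * (y * (μ * (a ^ 2 + 1) + x ^ 2) + μ * a) * h2
  exact (mul_eq_zero.mp this).resolve_left hμ.ne'

lemma det_rel (a μ x y : ℝ)
    (h1 : μ * (x - a) + x * y ^ 2 = 0)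
    (h2 : y * (μ * (a ^ 2 + 1) + x ^ 2) = μ * a) :
    (μ * (a ^ 2 + 1) + x ^ 2) *
      ((μ + y ^ 2) * (μ * (a ^ 2 + 1) + x ^ 2) - (2 * x * y) ^ 2) =
    μ * ((x ^ 2 + μ * (a ^ 2 + 1)) ^ 2 + 4 * x * (x ^ 2 + μ * (a ^ 2 + 1)) * (x - a)
      + μ * a ^ 2) := by
  linear_combination (-4 * x * (x ^ 2 + μ * (a ^ 2 + 1))) * h1
      + (y * (μ * (a ^ 2 + 1) + x ^ 2) + μ * a) * h2

lemma quad_zero (α β γ x₁ x₂ x₃ : ℝ) (h12 : x₂ < x₁) (h32 : x₃ < x₂)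
    (e1 : α * x₁ ^ 2 + β * x₁ + γ = 0) (e2 : α * x₂ ^ 2 + β * x₂ + γ = 0)
    (e3 : α * x₃ ^ 2 + β * x₃ + γ = 0) : α = 0 ∧ β = 0 ∧ γ = 0 := by
  have f1 : α * (x₁ + x₂) + β = 0 := by
    have : (x₁ - x₂) * (α * (x₁ + x₂) + β) = 0 := by linear_combination e1 - e2
    exact (mul_eq_zero.mp this).resolve_left (by linarith)
  have f2 : α * (x₂ + x₃) + β = 0 := by
    have : (x₂ - x₃) * (α * (x₂ + x₃) + β) = 0 := by linear_combination e2 - e3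
    exact (mul_eq_zero.mp this).resolve_left (by linarith)
  have f3 : α = 0 := by
    have : (x₁ - x₃) * α = 0 := by linear_combination f1 - f2
    exact (mul_eq_zero.mp this).resolve_left (by linarith)
  subst f3
  have : β = 0 := by linarith
  subst this
  exact ⟨rfl, rfl, by linarith⟩

lemma deriv_signs (a c m x₁ x₂ x₃ : ℝ) (ha : 0 < a) (hc : 0 < c)
    (p3 : 0 < x₃) (h32 : x₃ < x₂) (h12 : x₂ < x₁)
    (e1 : (x₁ - a) * (x₁ ^ 2 + c) ^ 2 + m * x₁ = 0)
    (e2 : (x₂ - a) * (x₂ ^ 2 + c) ^ 2 + m * x₂ = 0)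
    (e3 : (x₃ - a) * (x₃ ^ 2 + c) ^ 2 + m * x₃ = 0) :
    0 < (x₁ ^ 2 + c) ^ 2 + 4 * x₁ * (x₁ ^ 2 + c) * (x₁ - a) + m ∧
    (x₂ ^ 2 + c) ^ 2 + 4 * x₂ * (x₂ ^ 2 + c) * (x₂ - a) + m < 0 ∧
    0 < (x₃ ^ 2 + c) ^ 2 + 4 * x₃ * (x₃ ^ 2 + c) * (x₃ - a) + m := by
  have p2 : 0 < x₂ := by linarith
  have p1 : 0 < x₁ := by linarith
  obtain ⟨s1, hs1⟩ : ∃ s, s = x₁ + x₂ + x₃ := ⟨_, rfl⟩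
  obtain ⟨s2, hs2⟩ : ∃ s, s = x₁ * x₂ + x₁ * x₃ + x₂ * x₃ := ⟨_, rfl⟩
  obtain ⟨s3, hs3⟩ : ∃ s, s = x₁ * x₂ * x₃ := ⟨_, rfl⟩
  obtain ⟨b, hb⟩ : ∃ b, b = s1 - a := ⟨_, rfl⟩
  obtain ⟨d, hd⟩ : ∃ d, d = 2 * c + b * s1 - s2 := ⟨_, rfl⟩
  have id : ∀ x : ℝ, (x - a) * (x ^ 2 + c) ^ 2 + m * x =
      (x - x₁) * (x - x₂) * (x - x₃) * (x ^ 2 + b * x + d)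
      + ((-(2 * a * c) + s1 * d - s2 * b + s3) * x ^ 2 + (c ^ 2 + m - s2 * d + s3 * b) * x
      + (-(a * c ^ 2) + s3 * d)) := by
    intro x
    rw [hd, hb, hs1, hs2, hs3]
    ring
  obtain ⟨z1, z2, z3⟩ := quad_zero (-(2 * a * c) + s1 * d - s2 * b + s3)
    (c ^ 2 + m - s2 * d + s3 * b) (-(a * c ^ 2) + s3 * d) x₁ x₂ x₃ h12 h32
    (by have := id x₁; rw [e1] at this; linear_combination -this)
    (by have := id x₂; rw [e2] at this; linear_combination -this)
    (by have := id x₃; rw [e3] at this; linear_combination -this)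
  have s1p : 0 < s1 := by rw [hs1]; positivity
  have s3p : 0 < s3 := by rw [hs3]; positivity
  have dp : 0 < d := by
    have : 0 < s3 * d := by
      have : 0 < a * c ^ 2 := by positivity
      linarith
    exact pos_of_mul_pos_right this s3p.le
  have key : b * (s1 ^ 2 + d - b * s1) = s1 * s2 - s3 := by
    have hA : a = s1 - b := by linarith
    have hC : 2 * c = d - b * s1 + s2 := by linarith
    linear_combination z1 + (2 * c) * hA + (s1 - b) * hC
  have keyp : 0 < s1 * s2 - s3 := by
    rw [hs1, hs2, hs3]
    have : (x₁ + x₂ + x₃) * (x₁ * x₂ + x₁ * x₃ + x₂ * x₃) - x₁ * x₂ * x₃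
      = (x₁ + x₂) * (x₂ + x₃) * (x₁ + x₃) := by ring
    rw [this]; positivity
  have bp : 0 < b := by
    by_contra hcon
    push Not at hcon
    have : 0 ≤ s1 ^ 2 + d - b * s1 := by nlinarith [sq_nonneg s1]
    nlinarith [mul_nonneg (neg_nonneg.mpr hcon) this]
  have k1 : (x₁ ^ 2 + c) ^ 2 + 4 * x₁ * (x₁ ^ 2 + c) * (x₁ - a) + m =
      (x₁ - x₂) * (x₁ - x₃) * (x₁ ^ 2 + b * x₁ + d) := by
    have w1 := z1
    have w2 := z2
    rw [hd, hb, hs1, hs2, hs3] at w1 w2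
    rw [hd, hb, hs1, hs2]
    linear_combination (2 * x₁) * w1 + w2
  have k2 : (x₂ ^ 2 + c) ^ 2 + 4 * x₂ * (x₂ ^ 2 + c) * (x₂ - a) + m =
      -((x₁ - x₂) * (x₂ - x₃) * (x₂ ^ 2 + b * x₂ + d)) := by
    have w1 := z1
    have w2 := z2
    rw [hd, hb, hs1, hs2, hs3] at w1 w2
    rw [hd, hb, hs1, hs2]
    linear_combination (2 * x₂) * w1 + w2
  have k3 : (x₃ ^ 2 + c) ^ 2 + 4 * x₃ * (x₃ ^ 2 + c) * (x₃ - a) + m =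
      (x₁ - x₃) * (x₂ - x₃) * (x₃ ^ 2 + b * x₃ + d) := by
    have w1 := z1
    have w2 := z2
    rw [hd, hb, hs1, hs2, hs3] at w1 w2
    rw [hd, hb, hs1, hs2]
    linear_combination (2 * x₃) * w1 + w2
  have q12 : 0 < x₁ - x₂ := by linarith
  have q13 : 0 < x₁ - x₃ := by linarith
  have q23 : 0 < x₂ - x₃ := by linarith
  rw [k1, k2, k3]
  refine ⟨by positivity, ?_, by positivity⟩
  rw [neg_lt_zero]
  positivity

lemma posdef_of (a μ : ℝ) (hμ : 0 < μ) (p : ℝ × ℝ)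
    (hD : 0 < (μ + p.2 ^ 2) * (μ * (a ^ 2 + 1) + p.1 ^ 2) - (2 * p.1 * p.2) ^ 2) :
    (hess a μ p).PosDef := by
  have hA : 0 < μ + p.2 ^ 2 := by positivity
  unfold hess
  generalize μ + p.2 ^ 2 = A at *
  generalize μ * (a ^ 2 + 1) + p.1 ^ 2 = C at *
  generalize 2 * p.1 * p.2 = B at *
  refine Matrix.PosDef.of_dotProduct_mulVec_pos ?_ ?_
  · ext i j
    fin_cases i <;> fin_cases j <;> simp [Matrix.conjTranspose]
  · intro v hv
    have e : star v ⬝ᵥ (!![A, B; B, C] : Matrix (Fin 2) (Fin 2) ℝ).mulVec v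
        = A * v 0 ^ 2 + 2 * B * v 0 * v 1 + C * v 1 ^ 2 := by
      simp [Matrix.mulVec, dotProduct, Fin.sum_univ_two]
      ring
    rw [e]
    have e2 : A * (A * v 0 ^ 2 + 2 * B * v 0 * v 1 + C * v 1 ^ 2)
      = (A * v 0 + B * v 1) ^ 2 + (A * C - B ^ 2) * v 1 ^ 2 := by ring
    have : 0 < A * (A * v 0 ^ 2 + 2 * B * v 0 * v 1 + C * v 1 ^ 2) := by
      rw [e2]
      by_cases h1 : v 1 = 0
      · have h0 : v 0 ≠ 0 := by
          intro h0
          apply hv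
          ext i
          fin_cases i <;> simp [h0, h1]
        rw [h1]
        have : A * v 0 ≠ 0 := mul_ne_zero hA.ne' h0
        simp only [mul_zero, add_zero]
        positivity
      · positivity
    exact pos_of_mul_pos_right this hA.le

/-- for `0 < μ < τ` and the three positive critical points
`p₃.1 < p₂.1 < p₁.1` of `g_μ`, the Hessian is positive definite at `p₁` and `p₃`,
which are strict local minima, while at `p₂` the Hessian has positive trace and
negative determinant and `p₂` is a saddle point (neither a local min nor max). -/
theorem stmt15 (a τ μ : ℝ) (ha : 0 < a)
    (hτ : τ ∈ Set.Ioo 0 (a ^ 2 / 4))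
    (hτ0 : r a τ (yub a τ) = 0)
    (hτuniq : ∀ μ' ∈ Set.Ioo 0 (a ^ 2 / 4), r a μ' (yub a μ') = 0 → μ' = τ)
    (hμ : μ ∈ Set.Ioo 0 τ)
    (p₁ p₂ p₃ : ℝ × ℝ)
    (h₁ : 0 < p₁.1 ∧ 0 < p₁.2 ∧ fderiv ℝ (g a μ) p₁ = 0)
    (h₂ : 0 < p₂.1 ∧ 0 < p₂.2 ∧ fderiv ℝ (g a μ) p₂ = 0)
    (h₃ : 0 < p₃.1 ∧ 0 < p₃.2 ∧ fderiv ℝ (g a μ) p₃ = 0)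
    (horder : p₃.1 < p₂.1 ∧ p₂.1 < p₁.1)
    (hall : ∀ q : ℝ × ℝ, 0 < q.1 → 0 < q.2 → fderiv ℝ (g a μ) q = 0 →
      q = p₁ ∨ q = p₂ ∨ q = p₃) :
    (hess a μ p₁).PosDef ∧ (hess a μ p₃).PosDef ∧
    IsLocalMin (g a μ) p₁ ∧ (∀ᶠ q in 𝓝[≠] p₁, g a μ p₁ < g a μ q) ∧
    IsLocalMin (g a μ) p₃ ∧ (∀ᶠ q in 𝓝[≠] p₃, g a μ p₃ < g a μ q) ∧
    0 < (hess a μ p₂).trace ∧ (hess a μ p₂).det < 0 ∧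
    ¬ IsLocalMin (g a μ) p₂ ∧ ¬ IsLocalMax (g a μ) p₂ := by
  obtain ⟨hμ0, -⟩ := hμ
  obtain ⟨x1, y1, f1⟩ := h₁
  obtain ⟨x2, y2, f2⟩ := h₂
  obtain ⟨x3, y3, f3⟩ := h₃
  obtain ⟨u1, v1⟩ := crit_eqs a μ p₁ f1
  obtain ⟨u2, v2⟩ := crit_eqs a μ p₂ f2
  obtain ⟨u3, v3⟩ := crit_eqs a μ p₃ f3
  obtain ⟨s1, s2, s3⟩ := deriv_signs a (μ * (a ^ 2 + 1)) (μ * a ^ 2) p₁.1 p₂.1 p₃.1 ha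
    (by positivity) x3 horder.1 horder.2
    (quintic a μ _ _ hμ0 u1 v1) (quintic a μ _ _ hμ0 u2 v2) (quintic a μ _ _ hμ0 u3 v3)
  have d1 := det_rel a μ _ _ u1 v1
  have d2 := det_rel a μ _ _ u2 v2
  have d3 := det_rel a μ _ _ u3 v3
  have C1 : 0 < μ * (a ^ 2 + 1) + p₁.1 ^ 2 := by positivity
  have C2 : 0 < μ * (a ^ 2 + 1) + p₂.1 ^ 2 := by positivity
  have C3 : 0 < μ * (a ^ 2 + 1) + p₃.1 ^ 2 := by positivity
  have D1 := pos_of_mul_pos_right (d1 ▸ mul_pos hμ0 s1) C1.le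
  have D3 := pos_of_mul_pos_right (d3 ▸ mul_pos hμ0 s3) C3.le
  have D2 : (μ + p₂.2 ^ 2) * (μ * (a ^ 2 + 1) + p₂.1 ^ 2) - (2 * p₂.1 * p₂.2) ^ 2 < 0 := by
    have := mul_neg_of_pos_of_neg hμ0 s2
    rw [← d2] at this
    by_contra hcon
    push Not at hcon
    exact absurd (mul_nonneg C2.le hcon) (not_le.mpr this)
  have m1 := strict_min a μ hμ0 p₁ u1 v1 D1
  have m3 := strict_min a μ hμ0 p₃ u3 v3 D3
  have toMin : ∀ p, (∀ᶠ q in 𝓝[≠] p, g a μ p < g a μ q) → IsLocalMin (g a μ) p := by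
    intro p hp
    rw [eventually_nhdsWithin_iff] at hp
    filter_upwards [hp] with q hq
    by_cases h : q = p
    · rw [h]
    · exact (hq h).le
  obtain ⟨n1, n2⟩ := saddle a μ hμ0 p₂ u2 v2 D2
  refine ⟨posdef_of a μ hμ0 p₁ D1, posdef_of a μ hμ0 p₃ D3, toMin _ m1, m1, toMin _ m3, m3,
    ?_, ?_, n1, n2⟩
  · simp only [hess, Matrix.trace_fin_two_of]
    positivity
  · simp only [hess, Matrix.det_fin_two_of]
    linarith
end

section
/- Let a > 0 and let τ ∈ (0, a²/4) be the unique zero of μ ↦ r(y_ub(μ); μ). For every 0 < μ < τ, the solutions y*_μ < y**_μ < y***_μ of r(y;μ) = 0 satisfy y**_μ > √μ and y*_μ < ((4μ)^{1/3}/2)·(a^{1/3} − √(a^{2/3} − (4μ)^{1/3})). -/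
lemma r_hasDeriv (a l u y : ℝ) (hl : 0 < l) (hu : 0 < u) (hy : 0 < y)
    (h4 : 4 * (l * u) * a = (l + u) ^ 3) :
    HasDerivAt (r a (l * u)) (a * (((l + u) * y) ^ 3 - (y ^ 2 + l * u) ^ 3) /
      (y ^ 2 * (y ^ 2 + l * u) ^ 3)) y := by
  have hp : 0 < y ^ 2 + l * u := by positivity
  have h1 : HasDerivAt (fun y : ℝ => a / y) ((0 * y - a * 1) / y ^ 2) y :=
    (hasDerivAt_const y a).div (hasDerivAt_id y) hy.ne'
  have h2 : HasDerivAt (fun y : ℝ => (y ^ 2 + l * u) ^ 2)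
      (2 * (y ^ 2 + l * u) * (2 * y)) y := by
    have := (((hasDerivAt_id y).pow 2).add_const (l * u)).pow 2
    refine this.congr_deriv ?_
    simp
  have h3 := (hasDerivAt_const y (l * u * a ^ 2)).div h2 (by positivity)
  have h5 := (h1.sub h3).sub_const (a ^ 2 + 1)
  refine h5.congr_deriv ?_
  rw [mul_pow, ← h4]
  field_simp
  ring

lemma r_contOn (a l u : ℝ) (hl : 0 < l) (hu : 0 < u)
    (h4 : 4 * (l * u) * a = (l + u) ^ 3) (s : Set ℝ) (hs : ∀ y ∈ s, 0 < y) :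
    ContinuousOn (r a (l * u)) s := fun y hy =>
  (r_hasDeriv a l u y hl hu (hs y hy) h4).continuousAt.continuousWithinAt

lemma key_s16 (a l u : ℝ) (ha : 0 < a) (hl : 0 < l) (hlu : l < u)
    (h4 : 4 * (l * u) * a = (l + u) ^ 3) (y₁ y₂ y₃ : ℝ) (h0 : 0 < y₁) (h12 : y₁ < y₂)
    (h23 : y₂ < y₃) (h1 : r a (l * u) y₁ = 0) (h2 : r a (l * u) y₂ = 0)
    (h3 : r a (l * u) y₃ = 0) : Real.sqrt (l * u) < y₂ ∧ y₁ < l := by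
  have hu : 0 < u := hl.trans hlu
  have neg : ∀ y, 0 < y → 0 < (y - l) * (y - u) → deriv (r a (l * u)) y < 0 := by
    intro y hy h
    rw [(r_hasDeriv a l u y hl hu hy h4).deriv]
    apply div_neg_of_neg_of_pos _ (by positivity)
    apply mul_neg_of_pos_of_neg ha
    rw [sub_neg]
    apply pow_lt_pow_left₀ _ (by positivity) (by norm_num)
    nlinarith
  have pos : ∀ y, 0 < y → (y - l) * (y - u) < 0 → 0 < deriv (r a (l * u)) y := by
    intro y hy h
    rw [(r_hasDeriv a l u y hl hu hy h4).deriv]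
    apply div_pos _ (by positivity)
    apply mul_pos ha
    rw [sub_pos]
    apply pow_lt_pow_left₀ _ (by positivity) (by norm_num)
    nlinarith
  have A : StrictAntiOn (r a (l * u)) (Set.Ioc 0 l) := by
    refine strictAntiOn_of_deriv_neg (convex_Ioc _ _)
      (r_contOn a l u hl hu h4 _ fun y hy => hy.1) fun y hy => ?_
    rw [interior_Ioc] at hy
    exact neg y hy.1 (mul_pos_of_neg_of_neg (by linarith [hy.2]) (by linarith [hy.2]))
  have B : StrictMonoOn (r a (l * u)) (Set.Icc l u) := by
    refine strictMonoOn_of_deriv_pos (convex_Icc _ _)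
      (r_contOn a l u hl hu h4 _ fun y hy => hl.trans_le hy.1) fun y hy => ?_
    rw [interior_Icc] at hy
    exact pos y (hl.trans hy.1) (mul_neg_of_pos_of_neg (by linarith [hy.1]) (by linarith [hy.2]))
  have C : StrictAntiOn (r a (l * u)) (Set.Ici u) := by
    refine strictAntiOn_of_deriv_neg (convex_Ici _)
      (r_contOn a l u hl hu h4 _ fun y hy => hu.trans_le hy) fun y hy => ?_
    rw [interior_Ici] at hy
    have hy' : u < y := hy
    exact neg y (hu.trans hy) (mul_pos (by linarith) (by linarith))
  have hy1 : y₁ < l := by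
    by_contra! h
    rcases le_total y₂ u with h' | h'
    · have := B ⟨h, by linarith⟩ ⟨by linarith, h'⟩ h12
      linarith
    · have := C h' (h'.trans h23.le) h23
      linarith
  refine ⟨?_, hy1⟩
  by_contra! h
  have hm : 0 < l * u := by positivity
  have hs0 := Real.sqrt_pos.2 hm
  have hs := Real.sq_sqrt hm.le
  have hy2 : l < y₂ := by
    by_contra! h'
    have := A ⟨h0, hy1.le⟩ ⟨h0.trans h12, h'⟩ h12
    linarith
  have hsu : Real.sqrt (l * u) ≤ u := by
    rw [Real.sqrt_le_left hu.le]; nlinarith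
  have := B.monotoneOn ⟨hy2.le, h.trans hsu⟩ ⟨hy2.le.trans h, hsu⟩ h
  have e : r a (l * u) (Real.sqrt (l * u)) = -(a / (2 * Real.sqrt (l * u)) - 1) ^ 2 - a ^ 2 := by
    generalize Real.sqrt (l * u) = t at *
    rw [← hs]
    unfold r
    field_simp
    ring
  nlinarith [sq_nonneg (a / (2 * Real.sqrt (l * u)) - 1)]

/-- let `τ ∈ (0, a²/4)` be the unique zero of `μ ↦ r(y_ub(μ); μ)`.
For `0 < μ < τ` with positive solutions `y₁ < y₂ < y₃` of `r(·;μ) = 0`, one has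
`y₂ > √μ` and `y₁ < ((4μ)^{1/3}/2)(a^{1/3} - √(a^{2/3} - (4μ)^{1/3}))`. -/
theorem stmt16 (a τ μ : ℝ) (ha : 0 < a)
    (hτ : τ ∈ Set.Ioo 0 (a ^ 2 / 4))
    (hτ0 : r a τ (yub a τ) = 0)
    (hτuniq : ∀ μ' ∈ Set.Ioo 0 (a ^ 2 / 4), r a μ' (yub a μ') = 0 → μ' = τ)
    (hμ : μ ∈ Set.Ioo 0 τ)
    (y₁ y₂ y₃ : ℝ)
    (hy : 0 < y₁ ∧ y₁ < y₂ ∧ y₂ < y₃ ∧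
      r a μ y₁ = 0 ∧ r a μ y₂ = 0 ∧ r a μ y₃ = 0 ∧
      ∀ y : ℝ, 0 < y → r a μ y = 0 → y = y₁ ∨ y = y₂ ∨ y = y₃) :
    Real.sqrt μ < y₂ ∧
    y₁ < (4 * μ) ^ ((1 : ℝ) / 3) / 2 *
      (a ^ ((1 : ℝ) / 3) - Real.sqrt (a ^ ((2 : ℝ) / 3) - (4 * μ) ^ ((1 : ℝ) / 3))) := by
  obtain ⟨h0, h12, h23, h1, h2, h3, -⟩ := hy
  have hμ0 : 0 < μ := hμ.1
  have hμ4 : 4 * μ < a ^ 2 := by linarith [hμ.2, hτ.2]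
  have hq2 : a ^ ((2 : ℝ) / 3) = (a ^ ((1 : ℝ) / 3)) ^ 2 := by
    rw [← Real.rpow_natCast, ← Real.rpow_mul ha.le]; norm_num
  have hq3 : (a ^ ((1 : ℝ) / 3)) ^ 3 = a := by
    rw [← Real.rpow_natCast, ← Real.rpow_mul ha.le]; norm_num
  have hp3 : ((4 * μ) ^ ((1 : ℝ) / 3)) ^ 3 = 4 * μ := by
    rw [← Real.rpow_natCast, ← Real.rpow_mul (by positivity)]; norm_num
  have hq : 0 < a ^ ((1 : ℝ) / 3) := by positivity
  have hp : 0 < (4 * μ) ^ ((1 : ℝ) / 3) := by positivity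
  rw [hq2]
  generalize a ^ ((1 : ℝ) / 3) = q at *
  generalize (4 * μ) ^ ((1 : ℝ) / 3) = p at *
  have hpq : p < q ^ 2 := by
    apply lt_of_pow_lt_pow_left₀ 3 (by positivity)
    calc p ^ 3 < a ^ 2 := by rw [hp3]; exact hμ4
      _ = (q ^ 2) ^ 3 := by rw [← hq3]; ring
  have hs0 : 0 < Real.sqrt (q ^ 2 - p) := Real.sqrt_pos.2 (by linarith)
  have hs : Real.sqrt (q ^ 2 - p) ^ 2 = q ^ 2 - p := Real.sq_sqrt (by linarith)
  generalize Real.sqrt (q ^ 2 - p) = s at *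
  have hsq : s < q := by
    apply lt_of_pow_lt_pow_left₀ 2 hq.le
    linarith
  have hm : μ = p / 2 * (q - s) * (p / 2 * (q + s)) := by
    have : p / 2 * (q - s) * (p / 2 * (q + s)) = p ^ 2 / 4 * (q ^ 2 - s ^ 2) := by ring
    rw [this, hs]; linarith
  have hl : 0 < p / 2 * (q - s) := mul_pos (by positivity) (by linarith)
  have hlu : p / 2 * (q - s) < p / 2 * (q + s) :=
    mul_lt_mul_of_pos_left (by linarith) (by positivity)
  have h4 : 4 * (p / 2 * (q - s) * (p / 2 * (q + s))) * a =
      (p / 2 * (q - s) + p / 2 * (q + s)) ^ 3 := by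
    rw [← hm, ← hp3, ← hq3]; ring
  have k := key_s16 a _ _ ha hl hlu h4 y₁ y₂ y₃ h0 h12 h23 (hm ▸ h1) (hm ▸ h2) (hm ▸ h3)
  rw [← hm] at k
  exact k
end

section
/- Let a > 0, let τ ∈ (0, a²/4) be the unique zero of μ ↦ r(y_ub(μ); μ), and let 0 < μ < τ. Let (x*_μ, y*_μ), (x**_μ, y**_μ), (x***_μ, y***_μ) be the three solutions of ∇g_μ = 0 with x,y > 0, ordered with x***_μ < x**_μ < x*_μ. Define y_{μ1}(x) = √(μ(a − x)/x) and y_{μ2}(x) = μa/(μ(a²+1) + x²), and let C_{μ3} = {(x,y) : x**_μ < x ≤ x*_μ, y_{μ2}(x) ≤ y ≤ y_{μ1}(x)} ∪ {(x,y) : x*_μ < x ≤ a, y_{μ1}(x) ≤ y ≤ y_{μ2}(x)}. Then for every (x,y) ∈ C_{μ3} with (x,y) ≠ (x*_μ, y*_μ), one has g_μ(x,y) > g_μ(x*_μ, y*_μ). -/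
/-- `y_{μ1}(x) = √(μ(a - x)/x)`. -/
noncomputable def ymu1 (a μ x : ℝ) : ℝ := Real.sqrt (μ * (a - x) / x)

/-- `y_{μ2}(x) = μ a / (μ(a²+1) + x²)`. -/
noncomputable def ymu2 (a μ x : ℝ) : ℝ := μ * a / (μ * (a ^ 2 + 1) + x ^ 2)

lemma g_crit (a μ : ℝ) (p : ℝ × ℝ) (h : fderiv ℝ (g a μ) p = 0) :
    μ * (p.1 - a) + p.1 * p.2 ^ 2 = 0 ∧
    (μ * (a ^ 2 + 1) + p.1 ^ 2) * p.2 = μ * a := by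
  obtain ⟨x, y⟩ := p
  have hd : DifferentiableAt ℝ (g a μ) (x, y) := by
    unfold g; fun_prop
  have hf := hd.hasFDerivAt
  rw [h] at hf
  constructor
  · have hc : HasDerivAt (fun t : ℝ => (t, y)) ((1 : ℝ), (0 : ℝ)) x :=
      (hasDerivAt_id x).prodMk (hasDerivAt_const x y)
    have h1 := hf.comp_hasDerivAt x hc
    have h2 : HasDerivAt (g a μ ∘ fun t : ℝ => (t, y))
        (μ / 2 * (2 * (a - x) * (-1)) + 2 * x * y ^ 2 / 2) x := by
      have e : (g a μ ∘ fun t : ℝ => (t, y)) =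
        fun t => μ / 2 * ((1 - a * y) ^ 2 + y ^ 2 + (a - t) ^ 2 + 1) + t ^ 2 * y ^ 2 / 2 := rfl
      rw [e]
      have k1 : HasDerivAt (fun t : ℝ => (a - t) ^ 2) (2 * (a - x) * (-1)) x := by
        simpa using ((hasDerivAt_id x).const_sub a).fun_pow 2
      have k2 : HasDerivAt (fun t : ℝ => t ^ 2) (2 * x) x := by
        simpa using (hasDerivAt_id x).fun_pow 2
      exact (((k1.const_add ((1 - a * y) ^ 2 + y ^ 2)).add_const 1).const_mul (μ / 2)).add
        ((k2.mul_const (y ^ 2)).div_const 2)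
    have := h1.unique h2
    simp at this
    simp only
    linarith
  · have hc : HasDerivAt (fun t : ℝ => (x, t)) ((0 : ℝ), (1 : ℝ)) y :=
      (hasDerivAt_const y x).prodMk (hasDerivAt_id y)
    have h1 := hf.comp_hasDerivAt y hc
    have h2 : HasDerivAt (g a μ ∘ fun t : ℝ => (x, t))
        (μ / 2 * (2 * (1 - a * y) * (-a) + 2 * y) + x ^ 2 * (2 * y) / 2) y := by
      have e : (g a μ ∘ fun t : ℝ => (x, t)) =
        fun t => μ / 2 * ((1 - a * t) ^ 2 + t ^ 2 + (a - x) ^ 2 + 1) + x ^ 2 * t ^ 2 / 2 := rfl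
      rw [e]
      have k1 : HasDerivAt (fun t : ℝ => (1 - a * t) ^ 2) (2 * (1 - a * y) * (-a)) y := by
        simpa using (((hasDerivAt_id y).const_mul a).const_sub 1).fun_pow 2
      have k2 : HasDerivAt (fun t : ℝ => t ^ 2) (2 * y) y := by
        simpa using (hasDerivAt_id y).fun_pow 2
      exact ((((k1.add k2).add_const ((a - x) ^ 2)).add_const 1).const_mul (μ / 2)).add
        ((k2.const_mul (x ^ 2)).div_const 2)
    have := h1.unique h2
    simp at this
    simp only
    linarith

lemma quad_zero_s18 (A B C x y z : ℝ) (hxy : y < x) (hyz : z < y)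
    (h1 : A * x ^ 2 + B * x + C = 0) (h2 : A * y ^ 2 + B * y + C = 0)
    (h3 : A * z ^ 2 + B * z + C = 0) : A = 0 ∧ B = 0 ∧ C = 0 := by
  have e1 : A * (x + y) + B = 0 := by
    have : (x - y) * (A * (x + y) + B) = 0 := by linear_combination h1 - h2
    rcases mul_eq_zero.1 this with h | h
    · linarith
    · exact h
  have e2 : A * (y + z) + B = 0 := by
    have : (y - z) * (A * (y + z) + B) = 0 := by linear_combination h2 - h3
    rcases mul_eq_zero.1 this with h | h
    · linarith
    · exact h
  have hA : A = 0 := by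
    have : (x - z) * A = 0 := by linear_combination e1 - e2
    rcases mul_eq_zero.1 this with h | h
    · linarith
    · exact h
  subst hA
  have hB : B = 0 := by linarith
  subst hB
  exact ⟨rfl, rfl, by linarith⟩

lemma quintic_factor (a c m x y z : ℝ) (ha : 0 < a) (hc : 0 < c) (hz : 0 < z)
    (hxy : y < x) (hyz : z < y)
    (h1 : (x - a) * (c + x ^ 2) ^ 2 + m * x = 0)
    (h2 : (y - a) * (c + y ^ 2) ^ 2 + m * y = 0)
    (h3 : (z - a) * (c + z ^ 2) ^ 2 + m * z = 0) :
    ∃ b d : ℝ, 0 < b ∧ 0 < d ∧ ∀ t, (t - a) * (c + t ^ 2) ^ 2 + m * t =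
      (t - x) * (t - y) * (t - z) * (t ^ 2 + b * t + d) := by
  have hy : 0 < y := by linarith
  have hx : 0 < x := by linarith
  obtain ⟨b, hb⟩ : ∃ b, b = x + y + z - a := ⟨_, rfl⟩
  obtain ⟨d, hd⟩ : ∃ d, d = 2 * c - (x * y + y * z + x * z) + b * (x + y + z) := ⟨_, rfl⟩
  have key : ∀ t, (t - a) * (c + t ^ 2) ^ 2 + m * t =
      (t - x) * (t - y) * (t - z) * (t ^ 2 + b * t + d) +
      ((-2 * a * c + x * y * z - b * (x * y + y * z + x * z) + d * (x + y + z)) * t ^ 2 +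
      (c ^ 2 + m + b * (x * y * z) - d * (x * y + y * z + x * z)) * t
      + (-a * c ^ 2 + d * (x * y * z))) := by
    intro t
    rw [hd, hb]; ring
  have k1 := key x
  have k2 := key y
  have k3 := key z
  rw [h1] at k1
  rw [h2] at k2
  rw [h3] at k3
  obtain ⟨q1, q2, q3⟩ := quad_zero_s18
    (-2 * a * c + x * y * z - b * (x * y + y * z + x * z) + d * (x + y + z))
    (c ^ 2 + m + b * (x * y * z) - d * (x * y + y * z + x * z))
    (-a * c ^ 2 + d * (x * y * z)) x y z hxy hyz
    (by linear_combination -k1) (by linear_combination -k2) (by linear_combination -k3)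
  have hdpos : 0 < d := by
    have : 0 < d * (x * y * z) := by
      have : 0 < a * c ^ 2 := by positivity
      linarith
    exact pos_of_mul_pos_left this (by positivity)
  refine ⟨b, d, ?_, hdpos, ?_⟩
  · by_contra hneg
    obtain ⟨B, hB⟩ : ∃ B, B = -b := ⟨_, rfl⟩
    have hB0 : 0 ≤ B := by linarith
    have : ((x + y + z) * (x * y + y * z + x * z) - x * y * z) +
        B * (x + y + z) * (x + y + z + B) + B * d = 0 := by
      have ea : a = x + y + z + B := by linarith
      have ec : 2 * c = x * y + y * z + x * z + B * (x + y + z) + d := by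
        rw [hd, hB]; ring
      have eb : b = -B := by linarith
      rw [eb] at q1
      have : (x + y + z + B) * (x * y + y * z + x * z + B * (x + y + z) + d) = a * (2 * c) := by
        rw [← ea, ← ec]
      linear_combination this - q1
    have p1 : 0 < (x + y + z) * (x * y + y * z + x * z) - x * y * z := by
      have : (x + y + z) * (x * y + y * z + x * z) - x * y * z =
        x * (x * y + y * z + x * z) + y * (x * y + y * z + x * z) + z * (y * z + x * z) := by ring
      rw [this]; positivity
    have p2 : 0 ≤ B * (x + y + z) * (x + y + z + B) := by positivity
    have p3 : 0 ≤ B * d := by positivity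
    linarith
  · intro t
    rw [key t, q1, q2, q3]; ring

lemma crit_root (a μ : ℝ) (hμ : 0 < μ) (p : ℝ × ℝ)
    (h : 0 < p.1 ∧ 0 < p.2 ∧ fderiv ℝ (g a μ) p = 0) :
    (p.1 - a) * (μ * (a ^ 2 + 1) + p.1 ^ 2) ^ 2 + (μ * a ^ 2) * p.1 = 0 := by
  obtain ⟨e1, e2⟩ := g_crit a μ p h.2.2
  have : μ * ((p.1 - a) * (μ * (a ^ 2 + 1) + p.1 ^ 2) ^ 2 + (μ * a ^ 2) * p.1) = 0 := by
    linear_combination (μ * (a ^ 2 + 1) + p.1 ^ 2) ^ 2 * e1 -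
      p.1 * ((μ * (a ^ 2 + 1) + p.1 ^ 2) * p.2 + μ * a) * e2
  rcases mul_eq_zero.1 this with h | h
  · linarith
  · exact h

noncomputable def hred (a μ x : ℝ) : ℝ :=
  μ / 2 * (2 + (a - x) ^ 2) - μ ^ 2 * a ^ 2 / 2 / (μ * (a ^ 2 + 1) + x ^ 2)

lemma hred_deriv (a μ x : ℝ) (hμ : 0 < μ) :
    HasDerivAt (hred a μ) (μ * ((x - a) * (μ * (a ^ 2 + 1) + x ^ 2) ^ 2 + (μ * a ^ 2) * x) /
      (μ * (a ^ 2 + 1) + x ^ 2) ^ 2) x := by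
  have hD : μ * (a ^ 2 + 1) + x ^ 2 ≠ 0 := by positivity
  have k1 : HasDerivAt (fun t : ℝ => (a - t) ^ 2) (2 * (a - x) * (-1)) x := by
    simpa using ((hasDerivAt_id x).const_sub a).fun_pow 2
  have k2 : HasDerivAt (fun t : ℝ => t ^ 2) (2 * x) x := by
    simpa using (hasDerivAt_id x).fun_pow 2
  have k3 := ((k1.const_add 2).const_mul (μ / 2)).sub
    ((hasDerivAt_const x (μ ^ 2 * a ^ 2 / 2)).div (k2.const_add (μ * (a ^ 2 + 1))) hD)
  refine HasDerivAt.congr_deriv (f := hred a μ) k3 ?_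
  field_simp
  ring

lemma g_eq (a μ x y : ℝ) (hμ : 0 < μ) :
    g a μ (x, y) = hred a μ x + (μ * (a ^ 2 + 1) + x ^ 2) / 2 *
      (y - μ * a / (μ * (a ^ 2 + 1) + x ^ 2)) ^ 2 := by
  have hD : μ * (a ^ 2 + 1) + x ^ 2 ≠ 0 := by positivity
  unfold g hred
  field_simp
  ring

/-- with `τ` the unique zero of `μ ↦ r(y_ub(μ); μ)` in `(0, a²/4)`,
`0 < μ < τ`, and `p₁, p₂, p₃` the three positive critical points of `g_μ`
(ordered by `p₃.1 < p₂.1 < p₁.1`), every point of the region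
`C_{μ3} = {(x,y) : p₂.1 < x ≤ p₁.1, y_{μ2}(x) ≤ y ≤ y_{μ1}(x)} ∪
{(x,y) : p₁.1 < x ≤ a, y_{μ1}(x) ≤ y ≤ y_{μ2}(x)}` other than `p₁` has a strictly
larger `g_μ`-value than `p₁`. -/
theorem stmt18 (a τ μ : ℝ) (ha : 0 < a)
    (hτ : τ ∈ Set.Ioo 0 (a ^ 2 / 4))
    (hτ0 : r a τ (yub a τ) = 0)
    (hτuniq : ∀ μ' ∈ Set.Ioo 0 (a ^ 2 / 4), r a μ' (yub a μ') = 0 → μ' = τ)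
    (hμ : μ ∈ Set.Ioo 0 τ)
    (p₁ p₂ p₃ : ℝ × ℝ)
    (h₁ : 0 < p₁.1 ∧ 0 < p₁.2 ∧ fderiv ℝ (g a μ) p₁ = 0)
    (h₂ : 0 < p₂.1 ∧ 0 < p₂.2 ∧ fderiv ℝ (g a μ) p₂ = 0)
    (h₃ : 0 < p₃.1 ∧ 0 < p₃.2 ∧ fderiv ℝ (g a μ) p₃ = 0)
    (horder : p₃.1 < p₂.1 ∧ p₂.1 < p₁.1)
    (hall : ∀ q : ℝ × ℝ, 0 < q.1 → 0 < q.2 → fderiv ℝ (g a μ) q = 0 →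
      q = p₁ ∨ q = p₂ ∨ q = p₃) :
    ∀ x y : ℝ,
      ((p₂.1 < x ∧ x ≤ p₁.1 ∧ ymu2 a μ x ≤ y ∧ y ≤ ymu1 a μ x) ∨
       (p₁.1 < x ∧ x ≤ a ∧ ymu1 a μ x ≤ y ∧ y ≤ ymu2 a μ x)) →
      (x, y) ≠ p₁ →
      g a μ p₁ < g a μ (x, y) := by
  have hμ0 : 0 < μ := hμ.1
  obtain ⟨b, d, hb, hd, hfac⟩ := quintic_factor a (μ * (a ^ 2 + 1)) (μ * a ^ 2) p₁.1 p₂.1 p₃.1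
    ha (by positivity) h₃.1 horder.2 horder.1 (crit_root a μ hμ0 p₁ h₁)
    (crit_root a μ hμ0 p₂ h₂) (crit_root a μ hμ0 p₃ h₃)
  have hcont : Continuous (hred a μ) :=
    continuous_iff_continuousAt.2 fun x => (hred_deriv a μ x hμ0).continuousAt
  have hanti : StrictAntiOn (hred a μ) (Set.Icc p₂.1 p₁.1) := by
    apply strictAntiOn_of_deriv_neg (convex_Icc _ _) hcont.continuousOn
    intro t ht
    rw [interior_Icc] at ht
    have h0 : 0 < t := h₂.1.trans ht.1
    rw [(hred_deriv a μ t hμ0).deriv, hfac t]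
    apply div_neg_of_neg_of_pos _ (by positivity)
    apply mul_neg_of_pos_of_neg hμ0
    apply mul_neg_of_neg_of_pos _ (by positivity)
    apply mul_neg_of_neg_of_pos _ (by linarith [ht.1, horder.1])
    exact mul_neg_of_neg_of_pos (by linarith [ht.2]) (by linarith [ht.1])
  have hmono : StrictMonoOn (hred a μ) (Set.Ici p₁.1) := by
    apply strictMonoOn_of_deriv_pos (convex_Ici _) hcont.continuousOn
    intro t ht
    rw [interior_Ici] at ht
    have ht' : p₁.1 < t := ht
    have h0 : 0 < t := h₁.1.trans ht'
    rw [(hred_deriv a μ t hμ0).deriv, hfac t]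
    have u1 : 0 < t - p₁.1 := by linarith
    have u2 : 0 < t - p₂.1 := by linarith [horder.2]
    have u3 : 0 < t - p₃.1 := by linarith [horder.2, horder.1]
    positivity
  intro x y hxy hne
  have hx2 : p₂.1 < x := by
    rcases hxy with h | h
    · exact h.1
    · exact horder.2.trans h.1
  have e2 := (g_crit a μ p₁ h₁.2.2).2
  have hD1 : 0 < μ * (a ^ 2 + 1) + p₁.1 ^ 2 := by positivity
  have hD : 0 < μ * (a ^ 2 + 1) + x ^ 2 := by positivity
  have hy1 : p₁.2 = μ * a / (μ * (a ^ 2 + 1) + p₁.1 ^ 2) := by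
    rw [eq_div_iff hD1.ne']; linarith
  have hg1 : g a μ p₁ = hred a μ p₁.1 := by
    have := g_eq a μ p₁.1 p₁.2 hμ0
    rw [← hy1] at this
    simpa using this
  rw [hg1, g_eq a μ x y hμ0]
  have hsq : 0 ≤ (μ * (a ^ 2 + 1) + x ^ 2) / 2 *
      (y - μ * a / (μ * (a ^ 2 + 1) + x ^ 2)) ^ 2 := by positivity
  rcases lt_trichotomy x p₁.1 with h | h | h
  · have := hanti ⟨hx2.le, h.le⟩ ⟨horder.2.le, le_rfl⟩ h
    linarith
  · subst h
    rw [← hy1]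
    have hyne : y - p₁.2 ≠ 0 := by
      intro h0
      apply hne
      ext
      · rfl
      · simp only; linarith
    have : 0 < (μ * (a ^ 2 + 1) + p₁.1 ^ 2) / 2 * (y - p₁.2) ^ 2 := by positivity
    linarith
  · have := hmono (Set.mem_Ici.2 le_rfl) (Set.mem_Ici.2 h.le) h
    linarith
end
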